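/- arXiv:2604.09055 — 9 statements merged into one kernel-verified Lean document; each statement's English description precedes it below -/
import Mathlib

section
/- Let r be a positive integer, σ > 0, and suppose the true parameter is θ = 0. Let Z be standard normal and U be χ²_r (Gamma with shape r/2, rate 1/2), independent, and set X = σZ and W = σ²U. Let F be the cumulative distribution function of Z/√U. Define the plausibility of the assertion {θ = 0} by pl(X,W) = 2(1 − F(X/√W)) if F(X/√W) > 1/2, and pl(X,W) = 1 otherwise. Then for every α ∈ (0,1), P{pl(X,W) ≤ α} = α/2. -/
open MeasureTheory ProbabilityTheory Real

/-- The joint law of `(Z, U)` with `Z ~ N(0,1)` and `U ~ χ²_r` independent. -/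
noncomputable def jointZU (r : ℕ) : Measure (ℝ × ℝ) :=
  (gaussianReal 0 1).prod (gammaMeasure ((r : ℝ) / 2) (1 / 2))

/-- The CDF `F` of the pivot `Z/√U`. -/
noncomputable def pivotCDF (r : ℕ) : ℝ → ℝ :=
  cdf (Measure.map (fun p : ℝ × ℝ => p.1 / Real.sqrt p.2) (jointZU r))

open Filter Topology in
lemma cdf_upper_tail (ν : Measure ℝ) [IsProbabilityMeasure ν] (hat : ∀ x, ν {x} = 0)
    (c : ℝ) (h0 : 0 < c) (h1 : c < 1) :
    ν {x | c ≤ cdf ν x} = ENNReal.ofReal (1 - c) := by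
  have hleft : ∀ x, Function.leftLim (cdf ν) x = cdf ν x := by
    intro x
    have h := (cdf ν).measure_singleton x
    rw [measure_cdf, hat x] at h
    have h2 := ENNReal.ofReal_eq_zero.1 h.symm
    have h3 := (monotone_cdf ν).leftLim_le (le_refl x)
    linarith
  have hcont : Continuous (cdf ν) := by
    rw [continuous_iff_continuousAt]
    intro x
    rw [(monotone_cdf ν).continuousAt_iff_leftLim_eq_rightLim, hleft, (cdf ν).rightLim_eq]
  set S : Set ℝ := {x | c ≤ cdf ν x} with hS
  have hcl : IsClosed S := isClosed_le continuous_const hcont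
  obtain ⟨a, ha⟩ := ((tendsto_cdf_atBot ν).eventually (gt_mem_nhds h0)).exists
  obtain ⟨b, hb⟩ := ((tendsto_cdf_atTop ν).eventually (lt_mem_nhds h1)).exists
  have hne : S.Nonempty := ⟨b, le_of_lt hb⟩
  have hbd : BddBelow S := by
    refine ⟨a, fun x hx => ?_⟩
    by_contra hlt
    have hx' : c ≤ cdf ν x := hx
    have := monotone_cdf ν (not_le.1 hlt).le
    linarith
  have hmem : c ≤ cdf ν (sInf S) := hcl.csInf_mem hne hbd
  have hIci : S = Set.Ici (sInf S) := by
    ext x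
    exact ⟨fun hx => csInf_le hbd hx, fun hx => hmem.trans (monotone_cdf ν hx)⟩
  have heq : cdf ν (sInf S) = c := by
    refine le_antisymm ?_ hmem
    have ht : Tendsto (cdf ν) (𝓝[<] (sInf S)) (𝓝 (cdf ν (sInf S))) :=
      hcont.continuousAt.tendsto.mono_left nhdsWithin_le_nhds
    refine le_of_tendsto ht ?_
    filter_upwards [self_mem_nhdsWithin] with y hy
    by_contra hlt
    exact absurd (csInf_le hbd (show y ∈ S from (not_le.1 hlt).le)) (not_le.2 hy)
  have key := (cdf ν).measure_Ici (tendsto_cdf_atTop ν) (sInf S)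
  rw [measure_cdf, hleft, heq, ← hIci] at key
  exact key

lemma gamma_ae_pos (a b : ℝ) : ∀ᵐ u ∂(gammaMeasure a b), 0 < u := by
  have h : gammaMeasure a b (Set.Iic 0) = 0 := by
    rw [gammaMeasure, withDensity_apply _ measurableSet_Iic,
      setLIntegral_congr Iio_ae_eq_Iic.symm]
    exact lintegral_gammaPDF_of_nonpos le_rfl
  rw [ae_iff]
  convert h using 2
  ext u
  simp

lemma measurable_pivot : Measurable (fun p : ℝ × ℝ => p.1 / Real.sqrt p.2) := by
  fun_prop

lemma pivot_no_atoms (r : ℕ) (hr : 0 < r) (x : ℝ) :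
    Measure.map (fun p : ℝ × ℝ => p.1 / Real.sqrt p.2) (jointZU r) {x} = 0 := by
  have hr' : (0 : ℝ) < r := Nat.cast_pos.2 hr
  have : IsProbabilityMeasure (gammaMeasure ((r : ℝ) / 2) (1 / 2)) :=
    isProbabilityMeasure_gammaMeasure (by positivity) (by norm_num)
  have hm := measurable_pivot (measurableSet_singleton x)
  rw [Measure.map_apply measurable_pivot (measurableSet_singleton x), jointZU,
    Measure.prod_apply_symm hm, lintegral_eq_zero_iff (measurable_measure_prodMk_right hm)]
  filter_upwards [gamma_ae_pos ((r : ℝ) / 2) (1 / 2)] with u hu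
  have := noAtoms_gaussianReal (μ := 0) (v := 1) one_ne_zero
  refine measure_mono_null (t := {x * Real.sqrt u}) ?_ (measure_singleton _)
  intro z hz
  have hz' : z / Real.sqrt u = x := hz
  have := (Real.sqrt_pos.2 hu).ne'
  rw [Set.mem_singleton_iff, ← hz']
  field_simp

/-- **Validity at the boundary (θ₀ = 0), Theorem 2 of the paper.**
In the constrained normal model with true parameter `θ = 0`, set `X = σZ`, `W = σ²U`,
and define the plausibility of `{θ = 0}` by `pl = 2(1 − F(X/√W))` if `F(X/√W) > 1/2`
and `pl = 1` otherwise. Then `P{pl ≤ α} = α/2` for every `α ∈ (0,1)`. -/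
theorem im_plausibility_boundary_exact (r : ℕ) (hr : 0 < r) (σ : ℝ) (hσ : 0 < σ)
    (α : ℝ) (hα : α ∈ Set.Ioo (0 : ℝ) 1)
    (pl : ℝ × ℝ → ℝ)
    (hpl : ∀ p : ℝ × ℝ,
      pl p = if 1 / 2 < pivotCDF r ((σ * p.1) / Real.sqrt (σ ^ 2 * p.2))
        then 2 * (1 - pivotCDF r ((σ * p.1) / Real.sqrt (σ ^ 2 * p.2)))
        else 1) :
    jointZU r {p | pl p ≤ α} = ENNReal.ofReal (α / 2) := by
  obtain ⟨hα0, hα1⟩ := hα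
  have hr' : (0 : ℝ) < r := Nat.cast_pos.2 hr
  have : IsProbabilityMeasure (gammaMeasure ((r : ℝ) / 2) (1 / 2)) :=
    isProbabilityMeasure_gammaMeasure (by positivity) (by norm_num)
  have : IsProbabilityMeasure (jointZU r) := by unfold jointZU; infer_instance
  have : IsProbabilityMeasure
      (Measure.map (fun p : ℝ × ℝ => p.1 / Real.sqrt p.2) (jointZU r)) :=
    Measure.isProbabilityMeasure_map measurable_pivot.aemeasurable
  have key := cdf_upper_tail _ (pivot_no_atoms r hr) (1 - α / 2) (by linarith) (by linarith)
  have hset : MeasurableSet {x | 1 - α / 2 ≤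
      cdf (Measure.map (fun p : ℝ × ℝ => p.1 / Real.sqrt p.2) (jointZU r)) x} :=
    measurableSet_le measurable_const (monotone_cdf _).measurable
  rw [Measure.map_apply measurable_pivot hset] at key
  rw [show α / 2 = 1 - (1 - α / 2) by ring, ← key]
  congr 1
  ext p
  have hp : (σ * p.1) / Real.sqrt (σ ^ 2 * p.2) = p.1 / Real.sqrt p.2 := by
    rw [Real.sqrt_mul (sq_nonneg σ), Real.sqrt_sq hσ.le, mul_div_mul_left _ _ hσ.ne']
  simp only [Set.mem_setOf_eq, Set.mem_preimage, hpl, hp]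
  change _ ↔ 1 - α / 2 ≤ pivotCDF r (p.1 / Real.sqrt p.2)
  split_ifs with h
  · constructor <;> intro h' <;> linarith
  · constructor <;> intro h' <;> linarith
end

section
/- Let r be a positive integer and let F be the cumulative distribution function of Z/√U, where Z is standard normal and U ~ χ²_r are independent (F is continuous and strictly increasing). Fix reals x and w > 0, fix θ₀ > 0, and let Ṽ be uniformly distributed on [0,1]. Define the random interval I(Ṽ) = [ max{0, x − √w · F⁻¹(1/2 + |Ṽ − 1/2|)}, max{0, x − √w · F⁻¹(1/2 − |Ṽ − 1/2|)} ]. Then P{θ₀ ∈ I(Ṽ)} = 2F((x−θ₀)/√w) if F((x−θ₀)/√w) < 1/2, and P{θ₀ ∈ I(Ṽ)} = 2(1 − F((x−θ₀)/√w)) if F((x−θ₀)/√w) ≥ 1/2; equivalently P{θ₀ ∈ I(Ṽ)} = 1 − |2F((x−θ₀)/√w) − 1|. -/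
open MeasureTheory ProbabilityTheory Real

/-- **Plausibility as the hitting probability of the constrained predictive random set.**
Let `F` be the pivot CDF with inverse `Finv` on `(0,1)`, fix `x`, `w > 0`, `θ₀ > 0`, and
let `Ṽ ~ Unif[0,1]`.  For the random interval
`I(Ṽ) = [max{0, x − √w Finv(1/2 + |Ṽ−1/2|)}, max{0, x − √w Finv(1/2 − |Ṽ−1/2|)}]`,
the probability that `θ₀ ∈ I(Ṽ)` equals `2F((x−θ₀)/√w)` if `F((x−θ₀)/√w) < 1/2`,
equals `2(1 − F((x−θ₀)/√w))` if `F((x−θ₀)/√w) ≥ 1/2`, and in all cases equals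
`1 − |2F((x−θ₀)/√w) − 1|`. -/
theorem constrained_prs_hitting_probability (r : ℕ) (hr : 0 < r)
    (Finv : ℝ → ℝ) (hFinv : ∀ p ∈ Set.Ioo (0 : ℝ) 1, pivotCDF r (Finv p) = p)
    (x w θ₀ : ℝ) (hw : 0 < w) (hθ₀ : 0 < θ₀) :
    volume.restrict (Set.Icc (0 : ℝ) 1)
        {v | θ₀ ∈ Set.Icc (max 0 (x - Real.sqrt w * Finv (1 / 2 + |v - 1 / 2|)))
          (max 0 (x - Real.sqrt w * Finv (1 / 2 - |v - 1 / 2|)))} =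
      ENNReal.ofReal (1 - |2 * pivotCDF r ((x - θ₀) / Real.sqrt w) - 1|) ∧
    (pivotCDF r ((x - θ₀) / Real.sqrt w) < 1 / 2 →
      volume.restrict (Set.Icc (0 : ℝ) 1)
          {v | θ₀ ∈ Set.Icc (max 0 (x - Real.sqrt w * Finv (1 / 2 + |v - 1 / 2|)))
            (max 0 (x - Real.sqrt w * Finv (1 / 2 - |v - 1 / 2|)))} =
        ENNReal.ofReal (2 * pivotCDF r ((x - θ₀) / Real.sqrt w))) ∧
    (1 / 2 ≤ pivotCDF r ((x - θ₀) / Real.sqrt w) →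
      volume.restrict (Set.Icc (0 : ℝ) 1)
          {v | θ₀ ∈ Set.Icc (max 0 (x - Real.sqrt w * Finv (1 / 2 + |v - 1 / 2|)))
            (max 0 (x - Real.sqrt w * Finv (1 / 2 - |v - 1 / 2|)))} =
        ENNReal.ofReal (2 * (1 - pivotCDF r ((x - θ₀) / Real.sqrt w)))) := by
  set a := pivotCDF r ((x - θ₀) / Real.sqrt w) with ha
  have hmono : Monotone (pivotCDF r) := by
    unfold pivotCDF
    exact (cdf _).mono
  have ha0 : 0 ≤ a := by
    rw [ha]; unfold pivotCDF
    exact cdf_nonneg _ _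
  have ha1 : a ≤ 1 := by
    rw [ha]; unfold pivotCDF
    exact cdf_le_one _ _
  have hs : 0 < Real.sqrt w := Real.sqrt_pos.mpr hw
  have main : volume.restrict (Set.Icc (0 : ℝ) 1)
        {v | θ₀ ∈ Set.Icc (max 0 (x - Real.sqrt w * Finv (1 / 2 + |v - 1 / 2|)))
          (max 0 (x - Real.sqrt w * Finv (1 / 2 - |v - 1 / 2|)))} =
      ENNReal.ofReal (1 - |2 * a - 1|) := by
    have hd : |2 * a - 1| = 2 * |a - 1 / 2| := by
      rw [show 2 * a - 1 = 2 * (a - 1 / 2) by ring, abs_mul, abs_of_pos (by norm_num : (0:ℝ) < 2)]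
    rw [hd]
    have hdl : |a - 1 / 2| ≤ 1 / 2 := abs_le.mpr ⟨by linarith, by linarith⟩
    have hd0 : 0 ≤ |a - 1 / 2| := abs_nonneg _
    have h1 : a - 1 / 2 ≤ |a - 1 / 2| := le_abs_self _
    have h2 : -(a - 1 / 2) ≤ |a - 1 / 2| := neg_le_abs _
    have h3 : |a - 1 / 2| = a - 1 / 2 ∨ |a - 1 / 2| = -(a - 1 / 2) := abs_choice _
    generalize |a - 1 / 2| = d at *
    have hset : volume.restrict (Set.Icc (0 : ℝ) 1)
        {v | θ₀ ∈ Set.Icc (max 0 (x - Real.sqrt w * Finv (1 / 2 + |v - 1 / 2|)))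
          (max 0 (x - Real.sqrt w * Finv (1 / 2 - |v - 1 / 2|)))} =
        volume.restrict (Set.Icc (0 : ℝ) 1)
          (Set.Ico 0 (1 / 2 - d) ∪ Set.Ioc (1 / 2 + d) 1) := by
      apply measure_congr
      rw [Filter.eventuallyEq_set]
      have hne : ∀ c : ℝ, ∀ᵐ v ∂(volume.restrict (Set.Icc (0 : ℝ) 1)), v ≠ c := fun c =>
        ae_restrict_of_ae (Measure.ae_ne volume c)
      filter_upwards [hne 0, hne 1, hne (1 / 2), hne (1 / 2 - d), hne (1 / 2 + d),
        ae_restrict_mem measurableSet_Icc] with v n0 n1 nh nm np hv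
      have hv0 : 0 < v := lt_of_le_of_ne hv.1 (Ne.symm n0)
      have hv1 : v < 1 := lt_of_le_of_ne hv.2 n1
      have k1 : |v - 1 / 2| < 1 / 2 := abs_lt.mpr ⟨by linarith, by linarith⟩
      have k0 : 0 ≤ |v - 1 / 2| := abs_nonneg _
      have k2 : |v - 1 / 2| = v - 1 / 2 ∨ |v - 1 / 2| = -(v - 1 / 2) := abs_choice _
      have kne : |v - 1 / 2| ≠ d := by
        intro h
        rcases k2 with h' | h'
        · exact np (by linarith)
        · exact nm (by linarith)
      have e1 : (v ∈ Set.Ico 0 (1 / 2 - d) ∪ Set.Ioc (1 / 2 + d) 1) ↔ d < |v - 1 / 2| := by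
        rw [lt_abs]
        simp only [Set.mem_union, Set.mem_Ico, Set.mem_Ioc]
        constructor
        · rintro (h | h)
          · right; linarith [h.2]
          · left; linarith [h.1]
        · rintro (h | h)
          · right; exact ⟨by linarith, hv1.le⟩
          · left; exact ⟨hv0.le, by linarith⟩
      rw [e1]
      have fp := hFinv (1 / 2 + |v - 1 / 2|) ⟨by linarith, by linarith⟩
      have fm := hFinv (1 / 2 - |v - 1 / 2|) ⟨by linarith, by linarith⟩
      generalize |v - 1 / 2| = e at *
      simp only [Set.mem_setOf_eq, Set.mem_Icc, max_le_iff, le_max_iff]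
      constructor
      · rintro ⟨⟨-, g1⟩, g2⟩
        have g2 := g2.resolve_left (not_le.mpr hθ₀)
        have q1 : (x - θ₀) / Real.sqrt w ≤ Finv (1 / 2 + e) := by
          rw [div_le_iff₀ hs]; linarith
        have q2 : Finv (1 / 2 - e) ≤ (x - θ₀) / Real.sqrt w := by
          rw [le_div_iff₀ hs]; linarith
        have q1 := hmono q1
        have q2 := hmono q2
        rw [fp, ← ha] at q1
        rw [fm, ← ha] at q2
        refine lt_of_le_of_ne ?_ (Ne.symm kne)
        rcases h3 with h | h <;> linarith
      · intro h
        have q1 : (x - θ₀) / Real.sqrt w < Finv (1 / 2 + e) :=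
          hmono.reflect_lt (by rw [fp, ← ha]; linarith)
        have q2 : Finv (1 / 2 - e) < (x - θ₀) / Real.sqrt w :=
          hmono.reflect_lt (by rw [fm, ← ha]; linarith)
        rw [div_lt_iff₀ hs] at q1
        rw [lt_div_iff₀ hs] at q2
        exact ⟨⟨hθ₀.le, by linarith⟩, Or.inr (by linarith)⟩
    rw [hset, Measure.restrict_apply (measurableSet_Ico.union measurableSet_Ioc),
      Set.inter_eq_left.mpr, measure_union _ measurableSet_Ioc, Real.volume_Ico,
      Real.volume_Ioc, ← ENNReal.ofReal_add (by linarith) (by linarith)]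
    · congr 1; ring
    · rw [Set.disjoint_left]
      intro v p q
      linarith [p.2, q.1]
    · rintro v (p | p)
      · exact ⟨p.1, by linarith [p.2]⟩
      · exact ⟨by linarith [p.1], p.2⟩
  refine ⟨main, fun h => ?_, fun h => ?_⟩
  · rw [main, abs_of_neg (by linarith)]; congr 1; ring
  · rw [main, abs_of_nonneg (by linarith)]; congr 1; ring
end

section
/- Let θ ≥ 0 and let X be Poisson(θ)-distributed. For a positive integer j let G_j denote the CDF of the Gamma distribution with shape j and rate 1, and set G_0 ≡ 1 on [0,∞). Then for every t ∈ [0,1]: (i) P{G_X(θ) < t} ≤ t, and (ii) P{G_{X+1}(θ) > t} ≤ 1 − t. That is, the random variable G_X(θ) is stochastically no smaller than Unif(0,1) and G_{X+1}(θ) is stochastically no larger than Unif(0,1). -/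
open MeasureTheory ProbabilityTheory Real
open scoped NNReal

/-- The CDF of the Gamma distribution with shape `j ≥ 1` and rate `1`, with the
convention `G_0 ≡ 1`. -/
noncomputable def gammaCDFnat (j : ℕ) (l : ℝ) : ℝ :=
  if j = 0 then 1 else ∫ t in (0 : ℝ)..l, t ^ (j - 1) * Real.exp (-t) / (Nat.factorial (j - 1) : ℝ)

lemma hasDerivAt_poisson_tail (j : ℕ) (x : ℝ) :
    HasDerivAt (fun x : ℝ => - ∑ k ∈ Finset.range (j + 1), Real.exp (-x) * x ^ k / (Nat.factorial k : ℝ))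
      (x ^ j * Real.exp (-x) / (Nat.factorial j : ℝ)) x := by
  have he : HasDerivAt (fun x : ℝ => Real.exp (-x)) (-Real.exp (-x)) x := by
    simpa using (hasDerivAt_neg x).exp
  induction j with
  | zero => simpa using he.fun_neg
  | succ j ih =>
    have h2 := ((he.mul (hasDerivAt_pow (j + 1) x)).div_const (Nat.factorial (j + 1) : ℝ))
    have h3 := ih.sub h2
    refine (h3.congr_deriv ?_).congr_of_eventuallyEq (Filter.Eventually.of_forall fun y => ?_)
    · have : (Nat.factorial j : ℝ) ≠ 0 := by positivity
      rw [Nat.factorial_succ]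
      push_cast
      field_simp
      ring
    · simp only [Pi.sub_apply, Pi.mul_apply]
      rw [Finset.sum_range_succ _ (j + 1)]
      ring

lemma gammaCDFnat_eq (j : ℕ) (l : ℝ) :
    gammaCDFnat j l
      = 1 - ∑ k ∈ Finset.range j, Real.exp (-l) * l ^ k / (Nat.factorial k : ℝ) := by
  cases j with
  | zero => simp [gammaCDFnat]
  | succ j =>
    simp only [gammaCDFnat, Nat.add_sub_cancel, Nat.succ_ne_zero, if_false]
    rw [intervalIntegral.integral_eq_sub_of_hasDerivAt
      (fun x _ => hasDerivAt_poisson_tail j x)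
      (Continuous.intervalIntegrable (by fun_prop) _ _)]
    rw [Finset.sum_range_succ' (fun k => Real.exp (-(0:ℝ)) * (0:ℝ) ^ k / (Nat.factorial k : ℝ))]
    simp
    ring

lemma poisson_real_Iio (θ : ℝ≥0) (j : ℕ) :
    (poissonMeasure θ).real (Set.Iio j) = 1 - gammaCDFnat j (θ : ℝ) := by
  have : Set.Iio j = ((Finset.range j : Finset ℕ) : Set ℕ) := by ext; simp
  rw [gammaCDFnat_eq, this, ← sum_measureReal_singleton]
  simp [poissonMeasure_real_singleton]

lemma poisson_real_Ici (θ : ℝ≥0) (j : ℕ) :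
    (poissonMeasure θ).real (Set.Ici j) = gammaCDFnat j (θ : ℝ) := by
  have h := probReal_compl_eq_one_sub (μ := poissonMeasure θ) (s := Set.Iio j) (by measurability)
  rw [Set.compl_Iio, poisson_real_Iio] at h
  linarith

/-- **Gamma-quantile form of the validity of the discrete IM association.**
If `X ~ Poisson(θ)` then for every `t ∈ [0,1]`: (i) `P{G_X(θ) < t} ≤ t`, and
(ii) `P{G_{X+1}(θ) > t} ≤ 1 − t`; i.e. `G_X(θ)` is stochastically no smaller, and
`G_{X+1}(θ)` stochastically no larger, than `Unif(0,1)`. -/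
theorem gamma_cdf_stochastic_dominance (θ : ℝ≥0) (t : ℝ)
    (ht : t ∈ Set.Icc (0 : ℝ) 1) :
    poissonMeasure θ {n | gammaCDFnat n (θ : ℝ) < t} ≤ ENNReal.ofReal t ∧
    poissonMeasure θ {n | t < gammaCDFnat (n + 1) (θ : ℝ)} ≤ ENNReal.ofReal (1 - t) := by
  classical
  refine ⟨?_, ?_⟩
  · by_cases hS : ∃ n, gammaCDFnat n (θ : ℝ) < t
    · have hs : {n | gammaCDFnat n (θ : ℝ) < t} ⊆ Set.Ici (Nat.find hS) :=
        fun n hn => Nat.find_min' hS hn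
      refine (measure_mono hs).trans ?_
      rw [← ofReal_measureReal, poisson_real_Ici]
      exact ENNReal.ofReal_le_ofReal (Nat.find_spec hS).le
    · have hs : {n | gammaCDFnat n (θ : ℝ) < t} = ∅ := by
        ext n
        simpa using not_lt.mp (fun h => hS ⟨n, h⟩)
      rw [hs]
      simp
  · set S : Set ℕ := {n | t < gammaCDFnat (n + 1) (θ : ℝ)} with hSdef
    have hU : S = ⋃ n, S ∩ Set.Iio n := by
      rw [← Set.inter_iUnion, Set.iUnion_Iio, Set.inter_univ]
    have hm : Monotone (fun n : ℕ => S ∩ Set.Iio n) := fun a b hab =>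
      Set.inter_subset_inter_right _ (Set.Iio_subset_Iio hab)
    rw [hU, hm.measure_iUnion]
    refine iSup_le fun n => ?_
    induction n with
    | zero => simp
    | succ n ih =>
      by_cases hn : n ∈ S
      · refine (measure_mono Set.inter_subset_right).trans ?_
        rw [← ofReal_measureReal, poisson_real_Iio]
        have : t < gammaCDFnat (n + 1) (θ : ℝ) := hn
        exact ENNReal.ofReal_le_ofReal (by linarith)
      · refine (measure_mono ?_).trans ih
        rintro k ⟨hk, hkn⟩
        refine ⟨hk, ?_⟩
        have h1 : k ≠ n := fun h => hn (h ▸ hk)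
        simp only [Set.mem_Iio] at hkn ⊢
        omega
end

section
/- Fix m > 0, ε ≥ 0, λ₀ ≥ 0 and α ∈ (0,1). Let X ~ Poisson(ε + λ₀) and W ~ Poisson(mε) be independent. For a positive integer j let G_j⁻¹ denote the quantile function of the Gamma distribution with shape j and rate 1, with the convention G_0⁻¹ ≡ 0. For natural numbers x, w and real λ define K⁻_{x,w}(λ) = P{ G_x⁻¹(1−U) − G_{w+1}⁻¹(1−Ũ)/m ≤ λ } and K⁺_{x,w}(λ) = P{ G_{x+1}⁻¹(1−U) − G_w⁻¹(1−Ũ)/m ≤ λ }, where U, Ũ are independent Unif(0,1) random variables. Define the plausibility pl(x,w) of the assertion {λ = λ₀} by: pl(x,w) = min{1, 2K⁻_{x,w}(0)} if λ₀ = 0; and for λ₀ > 0, pl(x,w) = 2K⁻_{x,w}(λ₀) if K⁻_{x,w}(λ₀) < 1/2, pl(x,w) = 2(1 − K⁺_{x,w}(λ₀)) if K⁺_{x,w}(λ₀) > 1/2, and pl(x,w) = 1 otherwise. Then P{ pl(X,W) ≤ α } ≤ α. -/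
open MeasureTheory ProbabilityTheory Real
open scoped NNReal

/-- The quantile function of the Gamma distribution with shape `j` and rate `1`,
with the convention `G_0⁻¹ ≡ 0`. -/
noncomputable def gammaQuantile (j : ℕ) (p : ℝ) : ℝ :=
  if j = 0 then 0 else sInf {x : ℝ | p ≤ cdf (gammaMeasure (j : ℝ) 1) x}

/-- The joint law of two independent `Unif[0,1]` random variables `(U, Ũ)`. -/
noncomputable def unifSq : Measure (ℝ × ℝ) :=
  (volume.restrict (Set.Icc (0 : ℝ) 1)).prod (volume.restrict (Set.Icc (0 : ℝ) 1))

/-- `K⁻_{x,w}(λ) = P{ G_x⁻¹(1−U) − G_{w+1}⁻¹(1−Ũ)/m ≤ λ }`, the CDF of the lower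
random endpoint of the IM candidate set. -/
noncomputable def Kminus (m : ℝ) (x w : ℕ) (l : ℝ) : ℝ :=
  (unifSq {p | gammaQuantile x (1 - p.1) - gammaQuantile (w + 1) (1 - p.2) / m ≤ l}).toReal

/-- `K⁺_{x,w}(λ) = P{ G_{x+1}⁻¹(1−U) − G_w⁻¹(1−Ũ)/m ≤ λ }`, the CDF of the upper
random endpoint of the IM candidate set. -/
noncomputable def Kplus (m : ℝ) (x w : ℕ) (l : ℝ) : ℝ :=
  (unifSq {p | gammaQuantile (x + 1) (1 - p.1) - gammaQuantile w (1 - p.2) / m ≤ l}).toReal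

/-- The IM plausibility of the assertion `{λ = λ₀}` at data `(x, w)` in the constrained
Poisson model. -/
noncomputable def poissonPl (m l₀ : ℝ) (x w : ℕ) : ℝ :=
  if l₀ = 0 then min 1 (2 * Kminus m x w 0)
  else if Kminus m x w l₀ < 1 / 2 then 2 * Kminus m x w l₀
  else if 1 / 2 < Kplus m x w l₀ then 2 * (1 - Kplus m x w l₀)
  else 1

open Filter Topology intervalIntegral

noncomputable def pp (k : ℕ) (t : ℝ) : ℝ := exp (-t) * t ^ k / (k.factorial : ℝ)

noncomputable def qq (x : ℕ) (u : ℝ) : ℝ := 1 - ∑ k ∈ Finset.range x, pp k u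

noncomputable def AA (l r : ℝ) (i j : ℕ) (T : ℝ) : ℝ := ∫ t in (0:ℝ)..T, pp i t * pp j (l + r * t)

noncomputable def JJ (l r : ℝ) (x w : ℕ) (T : ℝ) : ℝ := ∫ t in (0:ℝ)..T, pp w t * qq x (l + r * t)

@[fun_prop]
lemma continuous_pp (k : ℕ) : Continuous (pp k) := by unfold pp; fun_prop

@[fun_prop]
lemma continuous_qq (k : ℕ) : Continuous (qq k) := by unfold qq; fun_prop

lemma pp_nonneg (k : ℕ) {t : ℝ} (ht : 0 ≤ t) : 0 ≤ pp k t := by unfold pp; positivity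

lemma pp_pos (k : ℕ) {t : ℝ} (ht : 0 < t) : 0 < pp k t := by unfold pp; positivity

lemma pp_succ (k : ℕ) (t : ℝ) : pp (k + 1) t = t / (k + 1) * pp k t := by
  unfold pp
  rw [Nat.factorial_succ]
  push_cast
  field_simp
  ring

lemma qq_zero (u : ℝ) : qq 0 u = 1 := by simp [qq]

lemma qq_succ (x : ℕ) (u : ℝ) : qq (x + 1) u = qq x u - pp x u := by
  simp [qq, Finset.sum_range_succ]; ring

lemma hasDerivAt_pp_zero (t : ℝ) : HasDerivAt (pp 0) (-pp 0 t) t := by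
  have : pp 0 = fun t => exp (-t) := by ext t; simp [pp]
  rw [this]
  have := (hasDerivAt_neg t).exp
  simpa using this

lemma hasDerivAt_pp_succ (k : ℕ) (t : ℝ) : HasDerivAt (pp (k + 1)) (pp k t - pp (k + 1) t) t := by
  have h := (((hasDerivAt_neg t).exp).mul (hasDerivAt_pow (k + 1) t)).div_const ((k + 1).factorial : ℝ)
  have h2 : HasDerivAt (pp (k + 1)) _ t := h
  convert h2 using 1
  unfold pp
  rw [Nat.factorial_succ]
  push_cast
  have : (k.factorial : ℝ) ≠ 0 := by positivity
  field_simp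
  ring_nf
  try simp

lemma hasDerivAt_qq_succ (x : ℕ) (u : ℝ) : HasDerivAt (qq (x + 1)) (pp x u) u := by
  induction x with
  | zero =>
    have : qq (0 + 1) = fun u => 1 - pp 0 u := by ext u; simp [qq]
    rw [this]
    simpa using (hasDerivAt_pp_zero u).const_sub 1
  | succ n ih =>
    have : qq (n + 1 + 1) = fun u => qq (n + 1) u - pp (n + 1) u := by ext u; exact qq_succ _ _
    rw [this]
    exact (ih.sub (hasDerivAt_pp_succ n u)).congr_deriv (by ring)

lemma hasSum_pp {u : ℝ} (hu : 0 ≤ u) : HasSum (fun k => pp k u) 1 :=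
  hasSum_one_poissonMeasure ⟨u, hu⟩

lemma qq_nonneg (x : ℕ) {u : ℝ} (hu : 0 ≤ u) : 0 ≤ qq x u := by
  unfold qq
  have := sum_le_hasSum (Finset.range x) (fun i _ => pp_nonneg i hu) (hasSum_pp hu)
  linarith

lemma qq_le_one (x : ℕ) {u : ℝ} (hu : 0 ≤ u) : qq x u ≤ 1 := by
  unfold qq
  have := Finset.sum_nonneg (s := Finset.range x) (fun i _ => pp_nonneg i hu)
  linarith

lemma tendsto_qq {u : ℝ} (hu : 0 ≤ u) : Tendsto (fun x => qq x u) atTop (𝓝 0) := by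
  unfold qq
  simpa using (hasSum_pp hu).tendsto_sum_nat.const_sub 1

lemma tendsto_pp (k : ℕ) : Tendsto (pp k) atTop (𝓝 0) := by
  have h := (Real.tendsto_pow_mul_exp_neg_atTop_nhds_zero k).div_const (k.factorial : ℝ)
  simp only [zero_div] at h
  refine h.congr fun t => ?_
  unfold pp; ring

lemma JJ_hor (l r : ℝ) (x w : ℕ) (T : ℝ) : JJ l r x w T - JJ l r (x + 1) w T = AA l r w x T := by
  unfold JJ AA
  rw [← intervalIntegral.integral_sub]
  · congr 1; ext t; rw [qq_succ]; ring
  · apply Continuous.intervalIntegrable; fun_prop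
  · apply Continuous.intervalIntegrable; fun_prop

lemma hasDerivAt_qq_aff (l r : ℝ) (x : ℕ) (t : ℝ) :
    HasDerivAt (fun t => qq (x + 1) (l + r * t)) (r * pp x (l + r * t)) t := by
  have h1 : HasDerivAt (fun t => l + r * t) r t := by
    simpa using ((hasDerivAt_id t).const_mul r).const_add l
  have := (hasDerivAt_qq_succ x (l + r * t)).comp t h1
  rw [mul_comm]
  exact this

lemma JJ_ver (l r : ℝ) (x w : ℕ) (T : ℝ) :
    JJ l r (x + 1) (w + 1) T - JJ l r (x + 1) w T + pp (w + 1) T * qq (x + 1) (l + r * T)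
      = r * AA l r (w + 1) x T := by
  have key := integral_eq_sub_of_hasDerivAt (a := 0) (b := T)
    (fun t _ => (hasDerivAt_pp_succ w t).mul (hasDerivAt_qq_aff l r x t))
    (by apply Continuous.intervalIntegrable; fun_prop)
  have e0 : pp (w + 1) 0 = 0 := by simp [pp]
  simp only [Pi.mul_apply, e0, zero_mul, sub_zero] at key
  rw [← key]
  unfold JJ AA
  rw [← intervalIntegral.integral_sub, ← intervalIntegral.integral_add,
    ← intervalIntegral.integral_const_mul]
  · congr 1; ext t; ring
  all_goals apply Continuous.intervalIntegrable; fun_prop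

lemma JJ_base (l r : ℝ) (x : ℕ) (T : ℝ) :
    JJ l r (x + 1) 0 T + pp 0 T * qq (x + 1) (l + r * T)
      = qq (x + 1) l + r * AA l r 0 x T := by
  have key := integral_eq_sub_of_hasDerivAt (a := 0) (b := T)
    (fun t _ => (hasDerivAt_pp_zero t).mul (hasDerivAt_qq_aff l r x t))
    (by apply Continuous.intervalIntegrable; fun_prop)
  have e0 : pp 0 0 = 1 := by simp [pp]
  simp only [Pi.mul_apply, e0, one_mul, mul_zero, add_zero] at key
  have : pp 0 T * qq (x + 1) (l + r * T) = qq (x + 1) l +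
    ∫ t in (0:ℝ)..T, (-pp 0 t * qq (x + 1) (l + r * t) + pp 0 t * (r * pp x (l + r * t))) := by
    rw [key]; ring
  rw [this]
  unfold JJ AA
  rw [add_left_comm, ← intervalIntegral.integral_add, ← intervalIntegral.integral_const_mul]
  · congr 2; ext t; ring
  all_goals apply Continuous.intervalIntegrable; fun_prop

lemma JJ_ver0 (l r : ℝ) (w : ℕ) (T : ℝ) :
    JJ l r 0 (w + 1) T - JJ l r 0 w T + pp (w + 1) T = 0 := by
  have key := integral_eq_sub_of_hasDerivAt (a := 0) (b := T)
    (fun t _ => (hasDerivAt_pp_succ w t))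
    (by apply Continuous.intervalIntegrable; fun_prop)
  have e0 : pp (w + 1) 0 = 0 := by simp [pp]
  rw [e0, sub_zero] at key
  rw [← key]
  unfold JJ
  rw [← intervalIntegral.integral_sub, ← intervalIntegral.integral_add]
  · simp [qq_zero]
  all_goals apply Continuous.intervalIntegrable; fun_prop

lemma JJ_base0 (l r : ℝ) (T : ℝ) : JJ l r 0 0 T + pp 0 T = 1 := by
  have key := integral_eq_sub_of_hasDerivAt (a := 0) (b := T)
    (fun t _ => (hasDerivAt_pp_zero t))
    (by apply Continuous.intervalIntegrable; fun_prop)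
  have e0 : pp 0 0 = 1 := by simp [pp]
  rw [e0, intervalIntegral.integral_neg] at key
  unfold JJ
  simp only [qq_zero, mul_one]
  linarith

lemma JJ_zero_eq (l r : ℝ) (w : ℕ) (T : ℝ) :
    JJ l r 0 w T = 1 - ∑ v ∈ Finset.range (w + 1), pp v T := by
  induction w with
  | zero => have := JJ_base0 l r T; simp; linarith
  | succ n ih => have := JJ_ver0 l r n T; rw [Finset.sum_range_succ]; linarith

lemma mlr {f s : ℝ → ℝ} (hf : Continuous f) (hs : Continuous s) {T S : ℝ} (hT : 0 ≤ T) (hS : T ≤ S)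
    (hfn : ∀ t, 0 ≤ t → 0 ≤ f t) (hsm : Monotone s) :
    (∫ t in (0:ℝ)..T, s t * f t) * (∫ t in (0:ℝ)..S, f t) ≤
      (∫ t in (0:ℝ)..T, f t) * (∫ t in (0:ℝ)..S, s t * f t) := by
  have i1 : ∀ a b, IntervalIntegrable f volume a b := fun a b => hf.intervalIntegrable a b
  have i2 : ∀ a b, IntervalIntegrable (fun t => s t * f t) volume a b :=
    fun a b => (hs.mul hf).intervalIntegrable a b
  rw [← integral_add_adjacent_intervals (i1 0 T) (i1 T S),
    ← integral_add_adjacent_intervals (i2 0 T) (i2 T S)]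
  have h1 : (∫ t in (0:ℝ)..T, s t * f t) ≤ s T * ∫ t in (0:ℝ)..T, f t := by
    rw [← intervalIntegral.integral_const_mul]
    apply integral_mono_on hT (i2 _ _) ((i1 _ _).const_mul _)
    intro t ht
    exact mul_le_mul_of_nonneg_right (hsm ht.2) (hfn t ht.1)
  have h2 : s T * (∫ t in T..S, f t) ≤ ∫ t in T..S, s t * f t := by
    rw [← intervalIntegral.integral_const_mul]
    apply integral_mono_on hS ((i1 _ _).const_mul _) (i2 _ _)
    intro t ht
    exact mul_le_mul_of_nonneg_right (hsm ht.1) (hfn t (hT.trans ht.1))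
  have n1 : 0 ≤ ∫ t in (0:ℝ)..T, f t := integral_nonneg hT fun t ht => hfn t ht.1
  have n2 : 0 ≤ ∫ t in T..S, f t := integral_nonneg hS fun t ht => hfn t (hT.trans ht.1)
  nlinarith [mul_le_mul_of_nonneg_right h1 n2, mul_le_mul_of_nonneg_left h2 n1]

lemma AA_mlr_i {l r : ℝ} (hl : 0 ≤ l) (hr : 0 ≤ r) (i j : ℕ) {T S : ℝ} (hT : 0 ≤ T) (hS : T ≤ S) :
    AA l r (i + 1) j T * AA l r i j S ≤ AA l r i j T * AA l r (i + 1) j S := by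
  have := mlr (f := fun t => pp i t * pp j (l + r * t)) (s := fun t => t / (i + 1))
    (by fun_prop) (by fun_prop) hT hS
    (fun t ht => mul_nonneg (pp_nonneg _ ht) (pp_nonneg _ (by positivity)))
    (fun a b hab => by dsimp only; gcongr)
  unfold AA
  simpa only [pp_succ, mul_assoc] using this

lemma AA_mlr_j {l r : ℝ} (hl : 0 ≤ l) (hr : 0 ≤ r) (i j : ℕ) {T S : ℝ} (hT : 0 ≤ T) (hS : T ≤ S) :
    AA l r i (j + 1) T * AA l r i j S ≤ AA l r i j T * AA l r i (j + 1) S := by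
  have := mlr (f := fun t => pp i t * pp j (l + r * t)) (s := fun t => (l + r * t) / (j + 1))
    (by fun_prop) (by fun_prop) hT hS
    (fun t ht => mul_nonneg (pp_nonneg _ ht) (pp_nonneg _ (by positivity)))
    (fun a b hab => by dsimp only; gcongr)
  unfold AA
  simpa only [pp_succ, mul_left_comm] using this

lemma AA_pos {l r : ℝ} (hl : 0 ≤ l) (hr : 0 < r) (i j : ℕ) {T : ℝ} (hT : 0 < T) :
    0 < AA l r i j T := by
  unfold AA
  apply intervalIntegral_pos_of_pos_on _ _ hT
  · apply Continuous.intervalIntegrable; fun_prop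
  · intro t ht
    have := ht.1
    exact mul_pos (pp_pos _ this) (pp_pos _ (by positivity))

lemma AA_mono {l r : ℝ} (hl : 0 ≤ l) (hr : 0 ≤ r) (i j : ℕ) {T S : ℝ} (hT : 0 ≤ T) (hS : T ≤ S) :
    AA l r i j T ≤ AA l r i j S := by
  unfold AA
  rw [← integral_add_adjacent_intervals (a := 0) (b := T) (c := S)]
  · have : 0 ≤ ∫ t in T..S, pp i t * pp j (l + r * t) := integral_nonneg hS fun t ht => by
      have := hT.trans ht.1
      exact mul_nonneg (pp_nonneg _ this) (pp_nonneg _ (by positivity))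
    linarith
  all_goals apply Continuous.intervalIntegrable; fun_prop

section core

variable {l r : ℝ} {K : ℕ → ℕ → ℝ}

lemma AA_tendsto (hK : ∀ x w, Tendsto (JJ l r x w) atTop (𝓝 (K x w))) (i j : ℕ) :
    Tendsto (AA l r i j) atTop (𝓝 (K j i - K (j + 1) i)) := by
  refine ((hK j i).sub (hK (j + 1) i)).congr fun T => JJ_hor l r j i T

lemma K_step_pos (hl : 0 ≤ l) (hr : 0 < r)
    (hK : ∀ x w, Tendsto (JJ l r x w) atTop (𝓝 (K x w))) (i j : ℕ) :
    0 < K j i - K (j + 1) i := by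
  refine lt_of_lt_of_le (AA_pos hl hr i j one_pos) ?_
  refine ge_of_tendsto (AA_tendsto hK i j) ?_
  filter_upwards [eventually_ge_atTop 1] with S hS
  exact AA_mono hl hr.le i j zero_le_one hS

lemma pp_qq_tendsto (hl : 0 ≤ l) (hr : 0 < r) (w x : ℕ) :
    Tendsto (fun T => pp w T * qq x (l + r * T)) atTop (𝓝 0) := by
  refine squeeze_zero' ?_ ?_ (tendsto_pp w)
  · filter_upwards [eventually_ge_atTop 0] with S hS
    exact mul_nonneg (pp_nonneg _ hS) (qq_nonneg _ (by positivity))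
  · filter_upwards [eventually_ge_atTop 0] with S hS
    exact mul_le_of_le_one_right (pp_nonneg _ hS) (qq_le_one _ (by positivity))

lemma K_ver (hl : 0 ≤ l) (hr : 0 < r)
    (hK : ∀ x w, Tendsto (JJ l r x w) atTop (𝓝 (K x w))) (x w : ℕ) :
    K (x + 1) (w + 1) - K (x + 1) w = r * (K x (w + 1) - K (x + 1) (w + 1)) := by
  have h1 := (((hK (x + 1) (w + 1)).sub (hK (x + 1) w)).add (pp_qq_tendsto hl hr (w + 1) (x + 1)))
  have h2 := (AA_tendsto hK (w + 1) x).const_mul r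
  rw [add_zero] at h1
  exact tendsto_nhds_unique (h1.congr fun T => JJ_ver l r x w T) h2

lemma K_base (hl : 0 ≤ l) (hr : 0 < r)
    (hK : ∀ x w, Tendsto (JJ l r x w) atTop (𝓝 (K x w))) (x : ℕ) :
    K (x + 1) 0 = qq (x + 1) l + r * (K x 0 - K (x + 1) 0) := by
  have h1 := ((hK (x + 1) 0).add (pp_qq_tendsto hl hr 0 (x + 1)))
  have h2 := ((AA_tendsto hK 0 x).const_mul r).const_add (qq (x + 1) l)
  rw [add_zero] at h1
  exact tendsto_nhds_unique (h1.congr fun T => JJ_base l r x T) h2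

lemma K_zero (hK : ∀ x w, Tendsto (JJ l r x w) atTop (𝓝 (K x w))) (w : ℕ) : K 0 w = 1 := by
  have h2 : Tendsto (fun T => 1 - ∑ v ∈ Finset.range (w + 1), pp v T) atTop (𝓝 (1 - 0)) := by
    have := tendsto_finsetSum (Finset.range (w + 1)) (fun v _ => tendsto_pp v)
    simpa using this.const_sub 1
  rw [sub_zero] at h2
  exact tendsto_nhds_unique ((hK 0 w).congr fun T => JJ_zero_eq l r w T) h2

lemma K_mono_w (hl : 0 ≤ l) (hr : 0 < r)
    (hK : ∀ x w, Tendsto (JJ l r x w) atTop (𝓝 (K x w))) (x w : ℕ) : K x w ≤ K x (w + 1) := by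
  cases x with
  | zero => rw [K_zero hK, K_zero hK]
  | succ x =>
    have := K_ver hl hr hK x w
    have := mul_pos hr (K_step_pos hl hr hK (w + 1) x)
    linarith

lemma K_base_le (hl : 0 ≤ l) (hr : 0 < r)
    (hK : ∀ x w, Tendsto (JJ l r x w) atTop (𝓝 (K x w))) (x : ℕ) : qq x l ≤ K x 0 := by
  cases x with
  | zero => rw [K_zero hK, qq_zero]
  | succ x =>
    have := K_base hl hr hK x
    have := mul_pos hr (K_step_pos hl hr hK 0 x)
    linarith

lemma K_anti_x (hl : 0 ≤ l) (hr : 0 < r)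
    (hK : ∀ x w, Tendsto (JJ l r x w) atTop (𝓝 (K x w))) (w : ℕ) : Antitone (fun x => K x w) :=
  antitone_nat_of_succ_le fun x => by linarith [K_step_pos hl hr hK w x]

/-- normalised partial masses -/
noncomputable def FF (l r : ℝ) (K : ℕ → ℕ → ℝ) (T : ℝ) (i j : ℕ) : ℝ :=
  AA l r i j T / (K j i - K (j + 1) i)

lemma FF_spec (hl : 0 ≤ l) (hr : 0 < r)
    (hK : ∀ x w, Tendsto (JJ l r x w) atTop (𝓝 (K x w))) (T : ℝ) (i j : ℕ) :
    AA l r i j T = (K j i - K (j + 1) i) * FF l r K T i j := by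
  have := K_step_pos hl hr hK i j
  unfold FF; field_simp

lemma FF_nonneg (hl : 0 ≤ l) (hr : 0 < r)
    (hK : ∀ x w, Tendsto (JJ l r x w) atTop (𝓝 (K x w))) {T : ℝ} (hT : 0 ≤ T) (i j : ℕ) :
    0 ≤ FF l r K T i j := by
  refine div_nonneg ?_ (K_step_pos hl hr hK i j).le
  have := AA_mono hl hr.le i j le_rfl hT
  simpa [AA] using this

lemma FF_le_one (hl : 0 ≤ l) (hr : 0 < r)
    (hK : ∀ x w, Tendsto (JJ l r x w) atTop (𝓝 (K x w))) {T : ℝ} (hT : 0 ≤ T) (i j : ℕ) :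
    FF l r K T i j ≤ 1 := by
  unfold FF
  rw [div_le_one (K_step_pos hl hr hK i j)]
  refine ge_of_tendsto (AA_tendsto hK i j) ?_
  filter_upwards [eventually_ge_atTop T] with S hS
  exact AA_mono hl hr.le i j hT hS

lemma FF_i (hl : 0 ≤ l) (hr : 0 < r)
    (hK : ∀ x w, Tendsto (JJ l r x w) atTop (𝓝 (K x w))) {T : ℝ} (hT : 0 ≤ T) (i j : ℕ) :
    FF l r K T (i + 1) j ≤ FF l r K T i j := by
  unfold FF
  rw [div_le_div_iff₀ (K_step_pos hl hr hK (i + 1) j) (K_step_pos hl hr hK i j)]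
  refine le_of_tendsto_of_tendsto ((AA_tendsto hK i j).const_mul _)
    ((AA_tendsto hK (i + 1) j).const_mul _) ?_
  filter_upwards [eventually_ge_atTop T] with S hS
  exact AA_mlr_i hl hr.le i j hT hS

lemma FF_j (hl : 0 ≤ l) (hr : 0 < r)
    (hK : ∀ x w, Tendsto (JJ l r x w) atTop (𝓝 (K x w))) {T : ℝ} (hT : 0 ≤ T) (i j : ℕ) :
    FF l r K T i (j + 1) ≤ FF l r K T i j := by
  unfold FF
  rw [div_le_div_iff₀ (K_step_pos hl hr hK i (j + 1)) (K_step_pos hl hr hK i j)]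
  refine le_of_tendsto_of_tendsto ((AA_tendsto hK i j).const_mul _)
    ((AA_tendsto hK i (j + 1)).const_mul _) ?_
  filter_upwards [eventually_ge_atTop T] with S hS
  exact AA_mlr_j hl hr.le i j hT hS

/-- The staircase invariant. -/
lemma staircase (hl : 0 ≤ l) (hr : 0 < r)
    (hK : ∀ x w, Tendsto (JJ l r x w) atTop (𝓝 (K x w))) {T : ℝ} (hT : 0 ≤ T)
    (c : ℕ → ℕ) (hc : ∀ w, c w ≤ c (w + 1)) (s a : ℝ)
    (h0 : s * (qq (c 0) l - a) ≤ 0)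
    (hs : ∀ w x, c w ≤ x → x ≤ c (w + 1) → s * (K x w - a) ≤ 0) (w : ℕ) :
    ∀ x, c w ≤ x → x ≤ c (w + 1) →
    s * ((∑ v ∈ Finset.range (w + 1), pp v T * qq (c v) (l + r * T)) + JJ l r x w T - a)
      ≤ s * (K x w - a) * FF l r K T w (x - 1) := by
  have hor : ∀ w, 
    s * ((∑ v ∈ Finset.range (w + 1), pp v T * qq (c v) (l + r * T)) + JJ l r (c w) w T - a)
      ≤ s * (K (c w) w - a) * FF l r K T w (c w - 1) →
    ∀ x, c w ≤ x → x ≤ c (w + 1) →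
    s * ((∑ v ∈ Finset.range (w + 1), pp v T * qq (c v) (l + r * T)) + JJ l r x w T - a)
      ≤ s * (K x w - a) * FF l r K T w (x - 1) := by
    intro w hw x hx
    induction x, hx using Nat.le_induction with
    | base => intro _; exact hw
    | succ x hx ih =>
      intro hx'
      have ih := ih (by omega)
      have e1 := JJ_hor l r x w T
      rw [FF_spec hl hr hK] at e1
      have hF : FF l r K T w x ≤ FF l r K T w (x - 1) := by
        cases x with
        | zero => exact le_rfl
        | succ y => exact FF_j hl hr hK hT w y
      have hs' := hs w x hx (by omega)
      have e2 : JJ l r (x + 1) w T = JJ l r x w T - (K x w - K (x + 1) w) * FF l r K T w x := by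
        linarith
      rw [e2]
      simp only [Nat.add_sub_cancel]
      nlinarith [mul_le_mul_of_nonpos_left hF hs']
  induction w with
  | zero =>
    apply hor
    rcases hcx : c 0 with _ | x
    · have e := JJ_base0 l r T
      have hF := FF_le_one hl hr hK hT 0 0
      rw [hcx, qq_zero] at h0
      simp only [zero_add, Finset.range_one, Finset.sum_singleton, hcx, qq_zero, K_zero hK,
        Nat.zero_sub]
      have : pp 0 T * 1 + JJ l r 0 0 T - a = 1 - a := by linarith
      rw [this]
      nlinarith [mul_le_mul_of_nonpos_left hF h0]
    · have e := JJ_base l r x T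
      rw [FF_spec hl hr hK] at e
      have hF := FF_le_one hl hr hK hT 0 x
      have ek := K_base hl hr hK x
      rw [hcx] at h0
      simp only [zero_add, Finset.range_one, Finset.sum_singleton, hcx, Nat.add_sub_cancel]
      have : pp 0 T * qq (x + 1) (l + r * T) + JJ l r (x + 1) 0 T - a =
        qq (x + 1) l - a + (K (x + 1) 0 - qq (x + 1) l) * FF l r K T 0 x := by
        have e3 : K (x + 1) 0 - qq (x + 1) l = r * (K x 0 - K (x + 1) 0) := by linarith
        rw [e3]; linarith
      rw [this]
      nlinarith [mul_le_mul_of_nonpos_left hF h0]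
  | succ w ih =>
    apply hor
    have ih := ih (c (w + 1)) (hc w) le_rfl
    have hs' := hs w (c (w + 1)) (hc w) le_rfl
    have hF := FF_i hl hr hK hT w (c (w + 1) - 1)
    rw [Finset.sum_range_succ]
    rcases hcx : c (w + 1) with _ | x
    · have e := JJ_ver0 l r w T
      rw [hcx] at ih hs' hF
      rw [K_zero hK] at ih hs' ⊢
      rw [qq_zero]
      have : JJ l r 0 (w + 1) T = JJ l r 0 w T - pp (w + 1) T := by linarith
      rw [this]
      nlinarith [mul_le_mul_of_nonpos_left hF hs']
    · have e := JJ_ver l r x w T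
      rw [FF_spec hl hr hK] at e
      have ek := K_ver hl hr hK x w
      rw [hcx] at ih hs' hF
      simp only [Nat.add_sub_cancel] at ih hF ⊢
      have : JJ l r (x + 1) (w + 1) T = JJ l r (x + 1) w T - pp (w + 1) T * qq (x + 1) (l + r * T)
        + (K (x + 1) (w + 1) - K (x + 1) w) * FF l r K T (w + 1) x := by rw [ek]; linarith
      rw [this]
      nlinarith [mul_le_mul_of_nonpos_left hF hs']

lemma upper_bound (hl : 0 ≤ l) (hr : 0 < r)
    (hK : ∀ x w, Tendsto (JJ l r x w) atTop (𝓝 (K x w))) {T : ℝ} (hT : 0 ≤ T)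
    (c : ℕ → ℕ) (a : ℝ) (hc : ∀ w x, K x w ≤ a ↔ c w ≤ x) (n : ℕ) :
    ∑ v ∈ Finset.range n, pp v T * qq (c v) (l + r * T) ≤ a := by
  have hcm : ∀ w, c w ≤ c (w + 1) := fun w =>
    (hc w _).1 ((K_mono_w hl hr hK _ w).trans ((hc (w + 1) _).2 le_rfl))
  have key := staircase hl hr hK hT c hcm 1 a
    (by have := (K_base_le hl hr hK (c 0)).trans ((hc 0 _).2 le_rfl); linarith)
    (fun w x h1 _ => by have := (hc w x).2 h1; linarith) n (c n) le_rfl (hcm n)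
  have hF := FF_nonneg hl hr hK hT n (c n - 1)
  have hk := (hc n _).2 le_rfl
  have hJ : 0 ≤ JJ l r (c n) n T := integral_nonneg hT fun t ht => by
    have := ht.1
    exact mul_nonneg (pp_nonneg _ this) (qq_nonneg _ (by positivity))
  have hp : 0 ≤ pp n T * qq (c n) (l + r * T) :=
    mul_nonneg (pp_nonneg _ hT) (qq_nonneg _ (by positivity))
  rw [Finset.sum_range_succ] at key
  nlinarith

lemma lower_bound (hl : 0 ≤ l) (hr : 0 < r)
    (hK : ∀ x w, Tendsto (JJ l r x w) atTop (𝓝 (K x w))) {T : ℝ} (hT : 0 ≤ T)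
    (c : ℕ → ℕ) (a : ℝ) (ha : a ≤ 1) (hc0 : ∀ x, a ≤ qq (x + 1) l ↔ x < c 0)
    (hc : ∀ w x, a ≤ K (x + 1) w ↔ x < c (w + 1)) (n : ℕ) :
    ∑ v ∈ Finset.range n, pp v T * (1 - qq (c v) (l + r * T)) ≤ 1 - a := by
  have hcm : ∀ w, c w ≤ c (w + 1) := by
    intro w
    by_contra! h
    refine lt_irrefl _ ((hc w (c (w + 1))).1 ?_)
    cases w with
    | zero => exact ((hc0 _).2 h).trans (K_base_le hl hr hK _)
    | succ w => exact ((hc _ _).2 h).trans (K_mono_w hl hr hK _ _)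
  have hk : ∀ w x, x ≤ c (w + 1) → a ≤ K x w := by
    intro w x hx
    cases x with
    | zero => rwa [K_zero hK]
    | succ y => exact (hc w y).2 hx
  have h0 : a ≤ qq (c 0) l := by
    rcases h : c 0 with _ | y
    · rwa [qq_zero]
    · exact (hc0 y).2 (by omega)
  have key := staircase hl hr hK hT c hcm (-1) a
    (by linarith) (fun w x _ h2 => by have := hk w x h2; linarith) n (c n) le_rfl (hcm n)
  have hF := FF_nonneg hl hr hK hT n (c n - 1)
  have hk := hk n (c n) (hcm n)
  have hJ : JJ l r (c n) n T ≤ JJ l r 0 n T := by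
    unfold JJ
    apply integral_mono_on hT
    · apply Continuous.intervalIntegrable; fun_prop
    · apply Continuous.intervalIntegrable; fun_prop
    intro t ht
    have := ht.1
    rw [qq_zero]
    exact mul_le_mul_of_nonneg_left (qq_le_one _ (by positivity)) (pp_nonneg _ this)
  rw [JJ_zero_eq] at hJ
  have hp : 0 ≤ pp n T * (1 - qq (c n) (l + r * T)) :=
    mul_nonneg (pp_nonneg _ hT) (sub_nonneg.2 (qq_le_one _ (by positivity)))
  simp only [mul_sub, mul_one, Finset.sum_sub_distrib] at hp ⊢
  rw [Finset.sum_range_succ] at key hJ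
  nlinarith

end core

open Set in
lemma gamma_eq (k : ℕ) : gammaMeasure ((k + 1 : ℕ) : ℝ) 1 =
    (volume.restrict (Ioi (0:ℝ))).withDensity (fun t => ENNReal.ofReal (pp k t)) := by
  have h : gammaPDF ((k + 1 : ℕ) : ℝ) 1 =
      (Ici (0:ℝ)).indicator (fun t => ENNReal.ofReal (pp k t)) := by
    ext t
    by_cases ht : 0 ≤ t
    · rw [gammaPDF_of_nonneg ht, indicator_of_mem (by exact ht)]
      congr 1
      push_cast
      rw [Real.Gamma_nat_eq_factorial, add_sub_cancel_right, Real.rpow_natCast]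
      unfold pp
      simp
      ring
    · rw [gammaPDF_of_neg (not_le.1 ht), indicator_of_notMem (by exact ht)]
  unfold gammaMeasure
  rw [h, withDensity_indicator measurableSet_Ici, restrict_Ioi_eq_restrict_Ici]

open Set in
lemma gamma_Iic (k : ℕ) {u : ℝ} (hu : 0 ≤ u) :
    gammaMeasure ((k + 1 : ℕ) : ℝ) 1 (Iic u) = ENNReal.ofReal (qq (k + 1) u) := by
  rw [gamma_eq, withDensity_apply _ measurableSet_Iic, Measure.restrict_restrict measurableSet_Iic,
    inter_comm, Ioi_inter_Iic, ← ofReal_integral_eq_lintegral_ofReal]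
  · rw [← intervalIntegral.integral_of_le hu]
    congr 1
    rw [integral_eq_sub_of_hasDerivAt (fun t _ => hasDerivAt_qq_succ k t)
      (by apply Continuous.intervalIntegrable; fun_prop)]
    have : qq (k + 1) 0 = 0 := by
      unfold qq
      rw [Finset.sum_range_succ']
      simp [pp]
    rw [this, sub_zero]
  · exact (continuous_pp k).integrableOn_Ioc
  · filter_upwards [ae_restrict_mem measurableSet_Ioc] with t ht
    exact pp_nonneg _ ht.1.le

/-- Gamma law with integer shape, with the convention that shape zero is a point mass at zero. -/
noncomputable def GG (j : ℕ) : Measure ℝ :=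
  if j = 0 then Measure.dirac 0 else gammaMeasure (j : ℝ) 1

lemma prob_gamma (k : ℕ) : IsProbabilityMeasure (gammaMeasure ((k + 1 : ℕ) : ℝ) 1) :=
  isProbabilityMeasure_gammaMeasure (by positivity) one_pos

instance prob_GG (j : ℕ) : IsProbabilityMeasure (GG j) := by
  unfold GG
  cases j with
  | zero => simp; infer_instance
  | succ k => simp only [Nat.succ_ne_zero, if_false]; exact prob_gamma k

lemma GG_Iic (j : ℕ) {u : ℝ} (hu : 0 ≤ u) : GG j (Set.Iic u) = ENNReal.ofReal (qq j u) := by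
  unfold GG
  cases j with
  | zero => simp [qq_zero, hu]
  | succ k => simp only [Nat.succ_ne_zero, if_false]; exact gamma_Iic k hu

lemma quantile_galois (k : ℕ) {p : ℝ} (h0 : 0 < p) (h1 : p < 1) (y : ℝ) :
    gammaQuantile (k + 1) p ≤ y ↔ p ≤ cdf (gammaMeasure ((k + 1 : ℕ) : ℝ) 1) y := by
  set F := cdf (gammaMeasure ((k + 1 : ℕ) : ℝ) 1) with hF
  have hmono : Monotone F := monotone_cdf _
  have hq : gammaQuantile (k + 1) p = sInf {x : ℝ | p ≤ F x} := by
    simp [gammaQuantile, hF]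
  rw [hq]
  have hne : {x : ℝ | p ≤ F x}.Nonempty := by
    have := ((tendsto_cdf_atTop (gammaMeasure ((k + 1 : ℕ) : ℝ) 1)).eventually
      (lt_mem_nhds h1)).exists
    obtain ⟨x, hx⟩ := this
    exact ⟨x, hx.le⟩
  have hbd : BddBelow {x : ℝ | p ≤ F x} := by
    obtain ⟨z, hz⟩ := ((tendsto_cdf_atBot (gammaMeasure ((k + 1 : ℕ) : ℝ) 1)).eventually
      (gt_mem_nhds h0)).exists
    refine ⟨z, fun x hx => ?_⟩
    by_contra! h
    exact absurd (hx.trans (hmono h.le)) (not_le.2 hz)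
  constructor
  · intro h
    by_contra! hlt
    have hr : ContinuousWithinAt F (Set.Ici y) y := F.right_continuous y
    have hev : ∀ᶠ z in 𝓝[>] y, F z < p :=
      (hr.mono Set.Ioi_subset_Ici_self).eventually (gt_mem_nhds hlt)
    obtain ⟨z, hz, hyz⟩ := (hev.and self_mem_nhdsWithin).exists
    have : z ≤ sInf {x : ℝ | p ≤ F x} := by
      refine le_csInf hne fun x hx => ?_
      by_contra! h'
      exact absurd (hx.trans (hmono h'.le)) (not_le.2 hz)
    exact absurd (this.trans h) (not_le.2 hyz)
  · intro h
    exact csInf_le hbd h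

lemma restrict_Icc_Ioo : volume.restrict (Set.Icc (0:ℝ) 1) = volume.restrict (Set.Ioo (0:ℝ) 1) :=
  (restrict_Ioo_eq_restrict_Icc).symm

lemma quantile_aemeasurable (j : ℕ) :
    AEMeasurable (fun u => gammaQuantile j (1 - u)) (volume.restrict (Set.Icc (0:ℝ) 1)) := by
  cases j with
  | zero => simp only [gammaQuantile, if_true]; exact aemeasurable_const
  | succ k =>
    rw [restrict_Icc_Ioo]
    apply aemeasurable_restrict_of_antitoneOn measurableSet_Ioo
    intro u hu v hv huv
    show gammaQuantile (k + 1) (1 - v) ≤ gammaQuantile (k + 1) (1 - u)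
    rw [quantile_galois k (by linarith [hv.2]) (by linarith [hv.1])]
    have := (quantile_galois k (p := 1 - u) (by linarith [hu.2]) (by linarith [hu.1]) _).1 le_rfl
    linarith

instance prob_unif : IsProbabilityMeasure (volume.restrict (Set.Icc (0:ℝ) 1)) :=
  ⟨by simp⟩

lemma quantile_map (j : ℕ) :
    (volume.restrict (Set.Icc (0:ℝ) 1)).map (fun u => gammaQuantile j (1 - u)) = GG j := by
  have hm := quantile_aemeasurable j
  cases j with
  | zero =>
    simp only [gammaQuantile, if_true, Measure.map_const, GG]
    simp
  | succ k =>
    have := Measure.isProbabilityMeasure_map hm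
    have := prob_gamma k
    have e : GG (k + 1) = gammaMeasure ((k + 1 : ℕ) : ℝ) 1 := by simp [GG]
    rw [e]
    apply Measure.ext_of_Iic
    intro y
    rw [Measure.map_apply_of_aemeasurable hm measurableSet_Iic, ← ofReal_cdf]
    set F := cdf (gammaMeasure ((k + 1 : ℕ) : ℝ) 1) y with hF
    have hF0 : 0 ≤ F := cdf_nonneg _ _
    have hF1 : F ≤ 1 := cdf_le_one _ _
    have : ((fun u => gammaQuantile (k + 1) (1 - u)) ⁻¹' Set.Iic y)
        =ᵐ[volume.restrict (Set.Icc (0:ℝ) 1)] Set.Ici (1 - F) := by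
      rw [restrict_Icc_Ioo]
      filter_upwards [ae_restrict_mem measurableSet_Ioo] with u hu
      apply propext
      show gammaQuantile (k + 1) (1 - u) ≤ y ↔ 1 - F ≤ u
      rw [quantile_galois k (by linarith [hu.2]) (by linarith [hu.1])]
      constructor <;> intro h <;> linarith
    rw [measure_congr this, Measure.restrict_apply measurableSet_Ici]
    have e2 : Set.Ici (1 - F) ∩ Set.Icc 0 1 = Set.Icc (1 - F) 1 := by
      ext u; simp only [Set.mem_inter_iff, Set.mem_Ici, Set.mem_Icc]
      constructor
      · rintro ⟨h1, h2, h3⟩; exact ⟨h1, h3⟩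
      · rintro ⟨h1, h3⟩; exact ⟨h1, by linarith, h3⟩
    rw [e2, Real.volume_Icc]
    congr 1; ring

lemma unifSq_eq (m : ℝ) (x w : ℕ) (l : ℝ) :
    unifSq {p | gammaQuantile x (1 - p.1) - gammaQuantile w (1 - p.2) / m ≤ l} =
      ((GG x).prod (GG w)) {q | q.1 - q.2 / m ≤ l} := by
  have h1 := quantile_aemeasurable x
  have h2 := quantile_aemeasurable w
  rw [← quantile_map x, ← quantile_map w, Measure.map_congr h1.ae_eq_mk,
    Measure.map_congr h2.ae_eq_mk]
  rw [Measure.map_prod_map _ _ h1.measurable_mk h2.measurable_mk, Measure.map_apply]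
  · unfold unifSq
    apply measure_congr
    have a1 := (Measure.quasiMeasurePreserving_fst (μ := volume.restrict (Set.Icc (0:ℝ) 1))
      (ν := volume.restrict (Set.Icc (0:ℝ) 1))).ae_eq_comp h1.ae_eq_mk
    have a2 := (Measure.quasiMeasurePreserving_snd (μ := volume.restrict (Set.Icc (0:ℝ) 1))
      (ν := volume.restrict (Set.Icc (0:ℝ) 1))).ae_eq_comp h2.ae_eq_mk
    filter_upwards [a1, a2] with p e1 e2
    apply propext
    simp only [Function.comp] at e1 e2
    show gammaQuantile x (1 - p.1) - gammaQuantile w (1 - p.2) / m ≤ l ↔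
      h1.mk _ p.1 - h2.mk _ p.2 / m ≤ l
    rw [e1, e2]
  · exact h1.measurable_mk.prodMap h2.measurable_mk
  · exact measurableSet_le (by fun_prop) (by fun_prop)

lemma GG_prod {m : ℝ} (x w : ℕ) (l : ℝ) :
    ((GG x).prod (GG w)) {q | q.1 - q.2 / m ≤ l} = ∫⁻ b, GG x (Set.Iic (l + b / m)) ∂(GG w) := by
  rw [Measure.prod_apply_symm (measurableSet_le (by fun_prop) (by fun_prop))]
  congr 1; ext b; congr 1; ext a
  simp only [Set.mem_preimage, Set.mem_ofPred_eq, Set.mem_Iic]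
  constructor <;> intro h <;> linarith

lemma Kplus_zero (m : ℝ) (x : ℕ) {l : ℝ} (hl : 0 ≤ l) : Kplus m x 0 l = qq (x + 1) l := by
  unfold Kplus
  rw [unifSq_eq, GG_prod]
  have : GG 0 = Measure.dirac 0 := by simp [GG]
  rw [this, lintegral_dirac, zero_div, add_zero, GG_Iic _ hl, ENNReal.toReal_ofReal (qq_nonneg _ hl)]

lemma pp_integrable (k : ℕ) : IntegrableOn (pp k) (Set.Ioi 0) := by
  refine ⟨(continuous_pp k).aestronglyMeasurable, ?_⟩
  rw [hasFiniteIntegral_iff_ofReal]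
  · have := (prob_gamma k).measure_univ
    rw [gamma_eq, withDensity_apply _ MeasurableSet.univ, Measure.restrict_univ] at this
    rw [this]; simp
  · filter_upwards [ae_restrict_mem measurableSet_Ioi] with t ht
    exact pp_nonneg _ (le_of_lt ht)

lemma ppqq_integrable {m l : ℝ} (hm : 0 < m) (hl : 0 ≤ l) (x k : ℕ) :
    IntegrableOn (fun t => pp k t * qq x (l + m⁻¹ * t)) (Set.Ioi 0) := by
  refine (pp_integrable k).mono' (by fun_prop) ?_
  filter_upwards [ae_restrict_mem measurableSet_Ioi] with t ht
  have ht : 0 < t := ht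
  have : 0 ≤ l + m⁻¹ * t := by positivity
  rw [Real.norm_of_nonneg (mul_nonneg (pp_nonneg _ ht.le) (qq_nonneg _ this))]
  exact mul_le_of_le_one_right (pp_nonneg _ ht.le) (qq_le_one _ this)

lemma Kminus_eq {m l : ℝ} (hm : 0 < m) (hl : 0 ≤ l) (x w : ℕ) :
    Kminus m x w l = ∫ t in Set.Ioi 0, pp w t * qq x (l + m⁻¹ * t) := by
  unfold Kminus
  rw [unifSq_eq, GG_prod]
  have e : GG (w + 1) = gammaMeasure ((w + 1 : ℕ) : ℝ) 1 := by simp [GG]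
  rw [e, gamma_eq, lintegral_withDensity_eq_lintegral_mul_non_measurable _ (by fun_prop)
    (by filter_upwards with t; exact ENNReal.ofReal_lt_top)]
  rw [integral_eq_lintegral_of_nonneg_ae _ (ppqq_integrable hm hl x w).aestronglyMeasurable]
  · congr 1
    apply lintegral_congr_ae
    filter_upwards [ae_restrict_mem measurableSet_Ioi] with t ht
    have ht : 0 < t := ht
    have : 0 ≤ l + m⁻¹ * t := by positivity
    rw [ENNReal.ofReal_mul (pp_nonneg _ ht.le), Pi.mul_apply, div_eq_inv_mul, GG_Iic _ this]
  · filter_upwards [ae_restrict_mem measurableSet_Ioi] with t ht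
    have ht : 0 < t := ht
    exact mul_nonneg (pp_nonneg _ ht.le) (qq_nonneg _ (by positivity))

lemma Kminus_lim {m l : ℝ} (hm : 0 < m) (hl : 0 ≤ l) (x w : ℕ) :
    Tendsto (JJ l m⁻¹ x w) atTop (𝓝 (Kminus m x w l)) := by
  rw [Kminus_eq hm hl]
  exact intervalIntegral_tendsto_integral_Ioi 0 (ppqq_integrable hm hl x w) tendsto_id

lemma Kminus_tendsto {m l : ℝ} (hm : 0 < m) (hl : 0 ≤ l) (w : ℕ) :
    Tendsto (fun x => Kminus m x w l) atTop (𝓝 0) := by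
  simp only [Kminus_eq hm hl]
  have := tendsto_integral_of_dominated_convergence (μ := volume.restrict (Set.Ioi (0:ℝ)))
    (F := fun x t => pp w t * qq x (l + m⁻¹ * t)) (f := fun _ => 0) (pp w)
    (fun x => (ppqq_integrable hm hl x w).aestronglyMeasurable) (pp_integrable w) ?_ ?_
  · simpa using this
  · intro x
    filter_upwards [ae_restrict_mem measurableSet_Ioi] with t ht
    have ht : 0 < t := ht
    have : 0 ≤ l + m⁻¹ * t := by positivity
    rw [Real.norm_of_nonneg (mul_nonneg (pp_nonneg _ ht.le) (qq_nonneg _ this))]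
    exact mul_le_of_le_one_right (pp_nonneg _ ht.le) (qq_le_one _ this)
  · filter_upwards [ae_restrict_mem measurableSet_Ioi] with t ht
    have ht : 0 < t := ht
    have : 0 ≤ l + m⁻¹ * t := by positivity
    simpa using (tendsto_qq this).const_mul (pp w t)

lemma poisson_Ici (u : ℝ≥0) (c : ℕ) :
    poissonMeasure u {x | x < c} = ENNReal.ofReal (1 - qq c u) := by
  have : {x | x < c} = ((Finset.range c : Finset ℕ) : Set ℕ) := by ext; simp
  rw [this, ← sum_measure_singleton]
  simp only [poissonMeasure_singleton]
  rw [← ENNReal.ofReal_sum_of_nonneg (fun i _ => by positivity)]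
  congr 1
  simp [qq, pp]

lemma poisson_Ici' (u : ℝ≥0) (c : ℕ) :
    poissonMeasure u {x | c ≤ x} = ENNReal.ofReal (qq c u) := by
  have : {x | c ≤ x} = {x | x < c}ᶜ := by ext; simp
  rw [this, prob_compl_eq_one_sub (MeasurableSet.of_discrete), poisson_Ici,
    ← ENNReal.ofReal_one, ← ENNReal.ofReal_sub _ (sub_nonneg.2 (qq_le_one c (NNReal.coe_nonneg u)))]
  congr 1; ring

lemma prod_bound (u v : ℝ≥0) (s : ℕ → Set ℕ) (g : ℕ → ℝ) (hg0 : ∀ n, 0 ≤ g n)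
    (hg : ∀ n, poissonMeasure u (s n) = ENNReal.ofReal (g n)) (a : ℝ)
    (h : ∀ n, ∑ k ∈ Finset.range n, pp k v * g k ≤ a) :
    ((poissonMeasure u).prod (poissonMeasure v)) {q | q.1 ∈ s q.2} ≤ ENNReal.ofReal a := by
  rw [Measure.prod_apply_symm (MeasurableSet.of_discrete), lintegral_countable']
  refine ENNReal.tsum_le_of_sum_range_le fun n => ?_
  refine le_trans (le_of_eq ?_) (ENNReal.ofReal_le_ofReal (h n))
  rw [ENNReal.ofReal_sum_of_nonneg (fun i _ => mul_nonneg (pp_nonneg i (NNReal.coe_nonneg v)) (hg0 i))]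
  refine Finset.sum_congr rfl fun k _ => ?_
  rw [poissonMeasure_singleton, mul_comm, ENNReal.ofReal_mul (pp_nonneg _ (NNReal.coe_nonneg v)), ← hg]
  rfl

lemma exists_threshold {f : ℕ → ℝ} (hf : Antitone f) (h : Tendsto f atTop (𝓝 0)) {a : ℝ}
    (ha : 0 < a) : (∃ c, ∀ x, f x ≤ a ↔ c ≤ x) ∧ (∃ c, ∀ x, a ≤ f x ↔ x < c) := by
  classical
  have hlt : ∃ x, f x < a := (h.eventually (gt_mem_nhds ha)).exists
  have hle : ∃ x, f x ≤ a := hlt.imp fun _ h => h.le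
  refine ⟨⟨Nat.find hle, fun x => ⟨fun hx => Nat.find_min' hle hx, fun hx => ?_⟩⟩,
    ⟨Nat.find hlt, fun x => ⟨fun hx => ?_, fun hx => ?_⟩⟩⟩
  · exact (hf hx).trans (Nat.find_spec hle)
  · by_contra! h'
    exact absurd ((hf h').trans_lt (Nat.find_spec hlt)) (not_lt.2 hx)
  · exact not_lt.1 (Nat.find_min hlt hx)

lemma lower_valid (m : ℝ≥0) (hm : 0 < m) (ε l : ℝ≥0) {a : ℝ} (ha : 0 < a) :
    ((poissonMeasure (ε + l)).prod (poissonMeasure (m * ε)))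
      {q | Kminus m q.1 q.2 l ≤ a} ≤ ENNReal.ofReal a := by
  have hm' : (0:ℝ) < m := hm
  have hl : (0:ℝ) ≤ l := l.2
  have hr : (0:ℝ) < (m:ℝ)⁻¹ := inv_pos.2 hm'
  have hK := Kminus_lim hm' hl
  have hth : ∀ w, ∃ c, ∀ x, Kminus m x w l ≤ a ↔ c ≤ x := fun w =>
    (exists_threshold (K_anti_x hl hr hK w) (Kminus_tendsto hm' hl w) ha).1
  choose c hc using hth
  have e : {q : ℕ × ℕ | Kminus m q.1 q.2 l ≤ a} = {q | q.1 ∈ {x | c q.2 ≤ x}} := by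
    ext q; exact hc q.2 q.1
  rw [e]
  refine prod_bound _ _ _ _ (fun n => qq_nonneg (c n) (NNReal.coe_nonneg (ε + l))) (fun n => poisson_Ici' _ _) a ?_
  intro n
  have := upper_bound hl hr hK (T := ((m * ε : ℝ≥0) : ℝ)) (NNReal.coe_nonneg _) c a hc n
  have e2 : (l:ℝ) + (m:ℝ)⁻¹ * ((m * ε : ℝ≥0) : ℝ) = ((ε + l : ℝ≥0) : ℝ) := by
    push_cast; field_simp; ring
  rwa [e2] at this

lemma upper_valid (m : ℝ≥0) (hm : 0 < m) (ε l : ℝ≥0) {a : ℝ} (ha : 0 < a) (ha1 : a < 1) :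
    ((poissonMeasure (ε + l)).prod (poissonMeasure (m * ε)))
      {q | 1 - Kplus m q.1 q.2 l ≤ a} ≤ ENNReal.ofReal a := by
  have hm' : (0:ℝ) < m := hm
  have hl : (0:ℝ) ≤ l := l.2
  have hr : (0:ℝ) < (m:ℝ)⁻¹ := inv_pos.2 hm'
  have hK := Kminus_lim hm' hl
  have hth : ∀ w, ∃ c, ∀ x, 1 - a ≤ Kplus m x w l ↔ x < c := by
    intro w
    cases w with
    | zero =>
      simp only [Kplus_zero _ _ hl]
      refine (exists_threshold (antitone_nat_of_succ_le fun x => ?_)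
        ((tendsto_qq hl).comp (tendsto_add_atTop_nat 1)) (by linarith)).2
      have := qq_succ (x + 1) l
      have := pp_nonneg (x + 1) hl
      simp only [Function.comp]
      linarith
    | succ w =>
      refine (exists_threshold (f := fun x => Kminus m (x + 1) w l) (fun x y hxy => ?_)
        ((Kminus_tendsto hm' hl w).comp (tendsto_add_atTop_nat 1)) (by linarith)).2
      exact K_anti_x hl hr hK w (by omega)
  choose c hc using hth
  have e : {q : ℕ × ℕ | 1 - Kplus m q.1 q.2 l ≤ a} = {q | q.1 ∈ {x | x < c q.2}} := by
    ext q
    simp only [Set.mem_ofPred_eq]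
    rw [← hc q.2 q.1]
    constructor <;> intro h <;> linarith
  rw [e]
  refine prod_bound _ _ _ _ (fun n => sub_nonneg.2 (qq_le_one (c n) (NNReal.coe_nonneg (ε + l))))
    (fun n => poisson_Ici _ _) a ?_
  intro n
  have := lower_bound hl hr hK (T := ((m * ε : ℝ≥0) : ℝ)) (NNReal.coe_nonneg _) c (1 - a)
    (by linarith) (fun x => by rw [← hc 0 x, Kplus_zero _ _ hl]) (fun w x => hc (w + 1) x) n
  have e2 : (l:ℝ) + (m:ℝ)⁻¹ * ((m * ε : ℝ≥0) : ℝ) = ((ε + l : ℝ≥0) : ℝ) := by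
    push_cast; field_simp; ring
  rw [e2, sub_sub_cancel] at this
  exact this

/-- **Validity of the IM plausibility function in the constrained Poisson model
(Theorem 3 of the paper).** If `X ~ Poisson(ε + λ₀)` and `W ~ Poisson(mε)` are
independent, then `P{ pl(X,W) ≤ α } ≤ α` for every `α ∈ (0,1)`. -/
theorem poisson_im_plausibility_valid (m : ℝ≥0) (hm : 0 < m) (ε l₀ : ℝ≥0)
    (α : ℝ) (hα : α ∈ Set.Ioo (0 : ℝ) 1) :
    ((poissonMeasure (ε + l₀)).prod (poissonMeasure (m * ε)))
        {q : ℕ × ℕ | poissonPl (m : ℝ) (l₀ : ℝ) q.1 q.2 ≤ α} ≤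
      ENNReal.ofReal α := by
  obtain ⟨h0, h1⟩ := hα
  have hsub : {q : ℕ × ℕ | poissonPl (m : ℝ) (l₀ : ℝ) q.1 q.2 ≤ α} ⊆
      {q | Kminus m q.1 q.2 l₀ ≤ α / 2} ∪ {q | 1 - Kplus m q.1 q.2 l₀ ≤ α / 2} := by
    intro q hq
    simp only [Set.mem_ofPred_eq, poissonPl] at hq
    simp only [Set.mem_union, Set.mem_ofPred_eq]
    split_ifs at hq with h2 h3 h4
    · left
      rw [h2]
      rcases min_le_iff.1 hq with h | h <;> linarith
    · left; linarith
    · right; linarith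
    · linarith
  refine (measure_mono hsub).trans ((measure_union_le _ _).trans ?_)
  refine (add_le_add (lower_valid m hm ε l₀ (half_pos h0))
    (upper_valid m hm ε l₀ (half_pos h0) (by linarith))).trans ?_
  rw [← ENNReal.ofReal_add (by linarith) (by linarith), add_halves]
end

section
/- Let r be a positive integer and fix reals x, θ and w > 0. Define f(w, x | θ, σ) = w^{r/2 − 1} · exp( −((x−θ)² + w) / (2σ²) ) / ( 2^{(r+1)/2} σ^{r+1} √π Γ(r/2) ) for σ > 0, and let s = √(w/r). Then ∫_0^∞ f(w, x | θ, σ) / σ dσ = (1/(2w)) · (1/s) · h_r((x−θ)/s), where h_r(t) = Γ((r+1)/2) / ( √(rπ) Γ(r/2) ) · (1 + t²/r)^{−(r+1)/2} is the Student-t density with r degrees of freedom. -/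
open MeasureTheory Real

/-- The joint density of `(W, X)` when `X ~ N(θ, σ²)` and `W ~ σ²χ²_r` are
independent. -/
noncomputable def jointDensityNormal (r : ℕ) (w x θ σ : ℝ) : ℝ :=
  w ^ ((r : ℝ) / 2 - 1) * Real.exp (-(((x - θ) ^ 2 + w) / (2 * σ ^ 2))) /
    ((2 : ℝ) ^ (((r : ℝ) + 1) / 2) * σ ^ (r + 1) * Real.sqrt π * Real.Gamma ((r : ℝ) / 2))

/-- The Student-t density with `r` degrees of freedom. -/
noncomputable def studentTDensity (r : ℕ) (t : ℝ) : ℝ :=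
  Real.Gamma (((r : ℝ) + 1) / 2) / (Real.sqrt ((r : ℝ) * π) * Real.Gamma ((r : ℝ) / 2)) *
    (1 + t ^ 2 / (r : ℝ)) ^ (-(((r : ℝ) + 1) / 2))

theorem aux_integral (r : ℕ) (A : ℝ) (hA : 0 < A) :
    ∫ σ in Set.Ioi (0 : ℝ), Real.exp (-(A / (2 * σ ^ 2))) / (σ ^ (r + 1) * σ) =
      1 / 2 * ((2 / A) ^ (((r : ℝ) + 1) / 2) * Real.Gamma (((r : ℝ) + 1) / 2)) := by
  have hm : 0 < ((r : ℝ) + 1) / 2 := by positivity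
  have h1 := Real.integral_rpow_mul_exp_neg_mul_Ioi hm (half_pos hA)
  rw [← integral_comp_rpow_Ioi _ (show (-2 : ℝ) ≠ 0 by norm_num)] at h1
  rw [show (2 / A) = 1 / (A / 2) by field_simp, ← h1, ← integral_const_mul]
  refine setIntegral_congr_fun measurableSet_Ioi fun y hy => ?_
  have hy : 0 < y := hy
  have e1 : y ^ (-2 : ℝ) = (y ^ 2)⁻¹ := by
    rw [Real.rpow_neg hy.le]; norm_num
  have e2 : y ^ (-2 - 1 : ℝ) * (y ^ (-2 : ℝ)) ^ (((r : ℝ) + 1) / 2 - 1) = (y ^ (r + 1) * y)⁻¹ := by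
    rw [← Real.rpow_mul hy.le, ← Real.rpow_add hy, ← pow_succ, ← Real.rpow_natCast,
      ← Real.rpow_neg hy.le]
    congr 1
    push_cast
    ring
  have e3 : A / (2 * y ^ 2) = A / 2 * y ^ (-2 : ℝ) := by
    rw [e1]; field_simp
  simp only [smul_eq_mul]
  rw [e3, div_eq_mul_inv, ← e2]
  norm_num
  ring

/-- **Integrating out `σ` against the improper prior `dσ/σ`.** For a positive integer
`r`, reals `x`, `θ` and `w > 0`, with `s = √(w/r)`,
`∫_0^∞ f(w,x|θ,σ)/σ dσ = (1/(2w)) (1/s) h_r((x−θ)/s)`,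
where `h_r` is the Student-t density with `r` degrees of freedom. -/
theorem marginalize_sigma_improper_prior (r : ℕ) (hr : 0 < r)
    (x θ w : ℝ) (hw : 0 < w) :
    ∫ σ in Set.Ioi (0 : ℝ), jointDensityNormal r w x θ σ / σ =
      1 / (2 * w) * (1 / Real.sqrt (w / r)) *
        studentTDensity r ((x - θ) / Real.sqrt (w / r)) := by
  have hr' : (0 : ℝ) < r := by exact_mod_cast hr
  set A := (x - θ) ^ 2 + w with hAdef
  have hA : 0 < A := by positivity
  have hG : 0 < Real.Gamma ((r : ℝ) / 2) := Real.Gamma_pos_of_pos (by positivity)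
  have key := aux_integral r A hA
  have e : ∀ σ : ℝ, jointDensityNormal r w x θ σ / σ =
      (w ^ ((r : ℝ) / 2 - 1) / ((2 : ℝ) ^ (((r : ℝ) + 1) / 2) * Real.sqrt π *
        Real.Gamma ((r : ℝ) / 2))) * (Real.exp (-(A / (2 * σ ^ 2))) / (σ ^ (r + 1) * σ)) := by
    intro σ
    rw [jointDensityNormal, div_div, div_mul_div_comm]
    congr 1
    ring
  simp_rw [e]
  rw [integral_const_mul, key, studentTDensity]
  have e4 : 1 + ((x - θ) / Real.sqrt (w / r)) ^ 2 / r = A / w := by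
    rw [div_pow, Real.sq_sqrt (by positivity), hAdef]
    field_simp
    ring
  rw [e4, Real.rpow_neg (by positivity), Real.div_rpow hA.le hw.le,
    Real.div_rpow (by norm_num) hA.le, Real.sqrt_div hw.le, Real.sqrt_mul hr'.le]
  have e5 : w ^ (((r : ℝ) + 1) / 2) = w ^ ((r : ℝ) / 2 - 1) * (w * Real.sqrt w) := by
    rw [Real.sqrt_eq_rpow, ← Real.rpow_one_add' hw.le (by norm_num), ← Real.rpow_add hw]
    congr 1
    ring
  rw [e5]
  have hw2 : 0 < Real.sqrt w := Real.sqrt_pos.2 hw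
  have hr2 : 0 < Real.sqrt (r : ℝ) := Real.sqrt_pos.2 hr'
  have hp2 : 0 < Real.sqrt π := Real.sqrt_pos.2 Real.pi_pos
  have hA2 : 0 < A ^ (((r : ℝ) + 1) / 2) := Real.rpow_pos_of_pos hA _
  have h22 : 0 < (2 : ℝ) ^ (((r : ℝ) + 1) / 2) := Real.rpow_pos_of_pos two_pos _
  generalize A ^ (((r : ℝ) + 1) / 2) = a at *
  generalize (2 : ℝ) ^ (((r : ℝ) + 1) / 2) = b at *
  generalize w ^ ((r : ℝ) / 2 - 1) = c at *
  generalize Real.sqrt w = d at *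
  generalize Real.sqrt (r : ℝ) = f at *
  generalize Real.sqrt π = g at *
  generalize Real.Gamma ((r : ℝ) / 2) = k at *
  field_simp
end

section
/- Let r be a positive integer and fix reals x and w > 0. Define f(w, x | θ, σ) = w^{r/2 − 1} · exp( −((x−θ)² + w) / (2σ²) ) / ( 2^{(r+1)/2} σ^{r+1} √π Γ(r/2) ) for σ > 0 and θ ∈ ℝ, and let s = √(w/r) and t = x/s. Then the double integral over the improper prior dσ dθ/σ on (0,∞) × (0,∞) satisfies ∫_0^∞ ∫_0^∞ f(w, x | θ, σ)/σ dσ dθ = H_r(t) / (2w), where H_r is the CDF of the Student-t distribution with r degrees of freedom, i.e., H_r(t) = ∫_{−∞}^t Γ((r+1)/2)/(√(rπ)Γ(r/2)) (1 + u²/r)^{−(r+1)/2} du. -/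
open MeasureTheory Real

/-- The Student-t CDF with `r` degrees of freedom:
`H_r(t) = ∫_{−∞}^t h_r(u) du`. -/
noncomputable def studentTCDF (r : ℕ) (t : ℝ) : ℝ :=
  ∫ u in Set.Iic t, studentTDensity r u

lemma inner_sigma (r : ℕ) (b : ℝ) (hb : 0 < b) :
    ∫ σ in Set.Ioi (0 : ℝ), Real.exp (-(b / σ ^ 2)) / σ ^ (r + 2) =
      b ^ (-(((r : ℝ) + 1) / 2)) * (1 / 2) * Real.Gamma (((r : ℝ) + 1) / 2) := by
  rw [← integral_comp_rpow_Ioi _ (show (-1 : ℝ) ≠ 0 by norm_num)]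
  have h := integral_rpow_mul_exp_neg_mul_rpow (p := 2) (q := r) (b := b) (by norm_num)
    (by have : (0 : ℝ) ≤ r := Nat.cast_nonneg r
        linarith) hb
  rw [neg_div] at h
  rw [← h]
  refine setIntegral_congr_fun measurableSet_Ioi (fun y hy => ?_)
  have hy : 0 < y := hy
  have h2 : y ^ ((-1 : ℝ) - 1) = (y ^ 2)⁻¹ := by
    rw [show ((-1 : ℝ) - 1) = -((2 : ℕ) : ℝ) by norm_num, Real.rpow_neg hy.le, Real.rpow_natCast]
  simp only [smul_eq_mul, h2, Real.rpow_neg_one, Real.rpow_natCast, Real.rpow_two]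
  have h3 : -(b / y⁻¹ ^ 2) = -b * y ^ 2 := by field_simp
  rw [h3]
  simp only [abs_neg, abs_one, inv_pow]
  field_simp
  try ring

lemma inner_eq (r : ℕ) (hr : 0 < r) (x w θ : ℝ) (hw : 0 < w) :
    ∫ σ in Set.Ioi (0 : ℝ), jointDensityNormal r w x θ σ / σ =
      studentTDensity r (x / Real.sqrt (w / r) - (Real.sqrt (w / r))⁻¹ * θ) *
        ((Real.sqrt (w / r))⁻¹ / (2 * w)) := by
  have hr' : (0 : ℝ) < r := by exact_mod_cast hr
  have hG : 0 < Real.Gamma ((r : ℝ) / 2) := Real.Gamma_pos_of_pos (by positivity)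
  have hb : 0 < ((x - θ) ^ 2 + w) / 2 := by positivity
  set C : ℝ := w ^ ((r : ℝ) / 2 - 1) /
    ((2 : ℝ) ^ (((r : ℝ) + 1) / 2) * Real.sqrt π * Real.Gamma ((r : ℝ) / 2)) with hC
  have h1 : ∫ σ in Set.Ioi (0 : ℝ), jointDensityNormal r w x θ σ / σ =
      ∫ σ in Set.Ioi (0 : ℝ),
        C * (Real.exp (-((((x - θ) ^ 2 + w) / 2) / σ ^ 2)) / σ ^ (r + 2)) := by
    refine setIntegral_congr_fun measurableSet_Ioi (fun y hy => ?_)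
    have hy : 0 < y := hy
    simp only [jointDensityNormal, hC]
    rw [show ((x - θ) ^ 2 + w) / 2 / y ^ 2 = ((x - θ) ^ 2 + w) / (2 * y ^ 2) by field_simp]
    have : (0 : ℝ) < 2 ^ (((r : ℝ) + 1) / 2) := by positivity
    field_simp
    ring
  rw [h1, integral_const_mul, inner_sigma r _ hb, hC, studentTDensity]
  have hs : (x / Real.sqrt (w / r) - (Real.sqrt (w / r))⁻¹ * θ) ^ 2 / r = (x - θ) ^ 2 / w := by
    rw [show x / Real.sqrt (w / r) - (Real.sqrt (w / r))⁻¹ * θ = (x - θ) / Real.sqrt (w / r) by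
      ring, div_pow, Real.sq_sqrt (by positivity)]
    field_simp
  rw [hs]
  have e1 : ((x - θ) ^ 2 + w) / 2 = (1 + (x - θ) ^ 2 / w) * w / 2 := by
    field_simp
    ring
  have hA : 0 < 1 + (x - θ) ^ 2 / w := by positivity
  rw [e1, Real.div_rpow (by positivity) (by norm_num), Real.mul_rpow hA.le hw.le,
    Real.rpow_neg (by norm_num : (0 : ℝ) ≤ 2)]
  have e2 : w ^ ((r : ℝ) / 2 - 1) * w ^ (-(((r : ℝ) + 1) / 2)) = (w * Real.sqrt w)⁻¹ := by
    rw [← Real.rpow_add hw, Real.sqrt_eq_rpow]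
    nth_rewrite 2 [← Real.rpow_one w]
    rw [← Real.rpow_add hw, ← Real.rpow_neg hw.le]
    congr 1
    ring
  have hsw : Real.sqrt w ≠ 0 := by positivity
  have h2 : (0 : ℝ) < 2 ^ (((r : ℝ) + 1) / 2) := by positivity
  rw [Real.sqrt_div hw.le, Real.sqrt_mul hr'.le]
  generalize (1 + (x - θ) ^ 2 / w) ^ (-(((r : ℝ) + 1) / 2)) = A at *
  generalize w ^ (-(((r : ℝ) + 1) / 2)) = B at *
  generalize w ^ ((r : ℝ) / 2 - 1) = D at *
  generalize (2 : ℝ) ^ (((r : ℝ) + 1) / 2) = T at *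
  have hsr : Real.sqrt r ≠ 0 := by positivity
  have e3 : D / (T * √π * Gamma ((r : ℝ) / 2)) * (A * B / T⁻¹ * (1 / 2) * Gamma (((r : ℝ) + 1) / 2)) =
    (D * B) * (A * Gamma (((r : ℝ) + 1) / 2) / (2 * √π * Gamma ((r : ℝ) / 2))) := by
    field_simp
  rw [e3, e2]
  field_simp

lemma shift_Iic (f : ℝ → ℝ) (t : ℝ) :
    ∫ u in Set.Ioi (0 : ℝ), f (t - u) = ∫ u in Set.Iic t, f u := by
  rw [integral_Iic_eq_integral_Iio, ← integral_indicator measurableSet_Ioi,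
    ← integral_indicator measurableSet_Iio, ← integral_sub_left_eq_self _ _ t]
  congr 1
  ext u
  simp [Set.indicator]

/-- **Marginal density of the data under the improper prior `dσ dθ/σ`.** For a positive
integer `r`, reals `x` and `w > 0`, with `s = √(w/r)` and `t = x/s`,
`∫_0^∞ ∫_0^∞ f(w,x|θ,σ)/σ dσ dθ = H_r(t)/(2w)`,
where `H_r` is the Student-t CDF with `r` degrees of freedom. -/
theorem marginal_density_improper_prior (r : ℕ) (hr : 0 < r)
    (x w : ℝ) (hw : 0 < w) :
    ∫ θ in Set.Ioi (0 : ℝ), ∫ σ in Set.Ioi (0 : ℝ), jointDensityNormal r w x θ σ / σ =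
      studentTCDF r (x / Real.sqrt (w / r)) / (2 * w) := by
  simp_rw [inner_eq r hr x w _ hw]
  have hr' : (0 : ℝ) < r := by exact_mod_cast hr
  have hs : 0 < Real.sqrt (w / r) := by positivity
  rw [integral_mul_const, integral_comp_mul_left_Ioi
    (fun u => studentTDensity r (x / Real.sqrt (w / r) - u)) 0 (inv_pos.mpr hs),
    mul_zero, shift_Iic, studentTCDF, smul_eq_mul, inv_inv]
  field_simp
end

section
/- Let r be a positive integer, α ∈ (0,1), and fix reals x and w > 0. Let s = √(w/r), t = x/s, let h_r and H_r be the density and CDF of the Student-t distribution with r degrees of freedom, and let g(θ) = h_r((θ−x)/s) / ( s · H_r(t) ) for θ ≥ 0 (the posterior density of the constrained normal mean under the prior 1/σ). Set b = max{ H_r⁻¹(1 − α·H_r(t)), H_r⁻¹( 1/2 + (1−α)·H_r(t)/2 ) }, l = max{0, x − b·s} and u = x + b·s. Then ∫_l^u g(θ) dθ = 1 − α. -/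
open MeasureTheory Real

lemma student_base_pos (r : ℕ) (t : ℝ) : 0 < 1 + t ^ 2 / (r : ℝ) := by positivity

lemma student_cont (r : ℕ) : Continuous (studentTDensity r) := by
  unfold studentTDensity
  refine continuous_const.mul (Continuous.rpow_const (by fun_prop) ?_)
  intro t
  exact Or.inl (student_base_pos r t).ne'

lemma student_pos (r : ℕ) (hr : 0 < r) (t : ℝ) : 0 < studentTDensity r t := by
  unfold studentTDensity
  have h1 : (0 : ℝ) < r := by exact_mod_cast hr
  have h2 := Real.Gamma_pos_of_pos (show 0 < ((r : ℝ) + 1) / 2 by positivity)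
  have h3 := Real.Gamma_pos_of_pos (show 0 < (r : ℝ) / 2 by positivity)
  have h4 := student_base_pos r t
  have h5 : 0 < Real.sqrt ((r : ℝ) * π) := Real.sqrt_pos.2 (by positivity)
  positivity

lemma student_even (r : ℕ) (t : ℝ) : studentTDensity r (-t) = studentTDensity r t := by
  simp [studentTDensity]

lemma inner_gamma (a c : ℝ) (ha : 0 < a) (hc : 0 < c) :
    ∫⁻ y in Set.Ioi (0 : ℝ), ENNReal.ofReal (y ^ (a - 1) * Real.exp (-(c * y)))
      = ENNReal.ofReal (c ^ (-a) * Real.Gamma a) := by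
  have h := Real.integral_rpow_mul_exp_neg_mul_Ioi ha hc
  have hpos : 0 < (1 / c) ^ a * Real.Gamma a :=
    mul_pos (by positivity) (Real.Gamma_pos_of_pos ha)
  rw [← ofReal_integral_eq_lintegral_ofReal]
  · rw [h, one_div, Real.inv_rpow hc.le, Real.rpow_neg hc.le]
  · by_contra hn
    rw [integral_undef hn] at h
    exact hpos.ne h
  · filter_upwards [ae_restrict_mem measurableSet_Ioi] with y hy
    have : (0 : ℝ) < y := hy
    positivity

lemma inner_gauss (d : ℝ) (hd : 0 < d) :
    ∫⁻ t : ℝ, ENNReal.ofReal (Real.exp (-d * t ^ 2)) = ENNReal.ofReal (Real.sqrt (π / d)) := by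
  rw [← ofReal_integral_eq_lintegral_ofReal (integrable_exp_neg_mul_sq hd)
    (Filter.Eventually.of_forall fun t => (Real.exp_pos _).le), integral_gaussian]

lemma student_kernel_lintegral (r : ℕ) (hr : 0 < r) :
    ∫⁻ t : ℝ, ENNReal.ofReal ((1 + t ^ 2 / (r : ℝ)) ^ (-(((r : ℝ) + 1) / 2)) *
        Real.Gamma (((r : ℝ) + 1) / 2))
      = ENNReal.ofReal (Real.sqrt ((r : ℝ) * π) * Real.Gamma ((r : ℝ) / 2)) := by
  have h1 : (0 : ℝ) < r := by exact_mod_cast hr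
  have ha : 0 < ((r : ℝ) + 1) / 2 := by positivity
  have e1 : ∀ t : ℝ, ENNReal.ofReal ((1 + t ^ 2 / (r : ℝ)) ^ (-(((r : ℝ) + 1) / 2)) *
        Real.Gamma (((r : ℝ) + 1) / 2)) = ∫⁻ y in Set.Ioi (0 : ℝ),
          ENNReal.ofReal (y ^ (((r : ℝ) + 1) / 2 - 1) * Real.exp (-((1 + t ^ 2 / (r : ℝ)) * y))) :=
    fun t => (inner_gamma _ _ ha (student_base_pos r t)).symm
  simp_rw [e1]
  rw [lintegral_lintegral_swap]
  · have e2 : ∀ y ∈ Set.Ioi (0 : ℝ), ∫⁻ t : ℝ,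
          ENNReal.ofReal (y ^ (((r : ℝ) + 1) / 2 - 1) * Real.exp (-((1 + t ^ 2 / (r : ℝ)) * y)))
        = ENNReal.ofReal (Real.sqrt ((r : ℝ) * π)) *
          ENNReal.ofReal (y ^ ((r : ℝ) / 2 - 1) * Real.exp (-(1 * y))) := by
      intro y hy
      have hy : (0 : ℝ) < y := hy
      have e3 : ∀ t : ℝ, ENNReal.ofReal (y ^ (((r : ℝ) + 1) / 2 - 1) *
          Real.exp (-((1 + t ^ 2 / (r : ℝ)) * y))) =
          ENNReal.ofReal (y ^ (((r : ℝ) + 1) / 2 - 1) * Real.exp (-(1 * y))) *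
            ENNReal.ofReal (Real.exp (-(y / r) * t ^ 2)) := by
        intro t
        rw [← ENNReal.ofReal_mul (by positivity), mul_assoc, ← Real.exp_add]
        congr 3
        ring
      simp_rw [e3]
      rw [lintegral_const_mul _ (by fun_prop), inner_gauss _ (by positivity),
        ← ENNReal.ofReal_mul (by positivity), ← ENNReal.ofReal_mul (by positivity)]
      congr 1
      have e4 : π / (y / r) = (r * π) / y := by field_simp
      have e5 : y ^ (((r : ℝ) + 1) / 2 - 1) = y ^ ((r : ℝ) / 2 - 1) * Real.sqrt y := by
        rw [Real.sqrt_eq_rpow, ← Real.rpow_add hy]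
        congr 1
        ring
      have hsy : 0 < Real.sqrt y := Real.sqrt_pos.2 hy
      rw [e4, e5, Real.sqrt_div (by positivity)]
      field_simp
    rw [setLIntegral_congr_fun measurableSet_Ioi e2, lintegral_const_mul _ (by fun_prop),
      inner_gamma _ _ (by positivity) one_pos, ← ENNReal.ofReal_mul (by positivity)]
    simp
  · apply Measurable.aemeasurable
    unfold Function.uncurry
    fun_prop

lemma student_lintegral (r : ℕ) (hr : 0 < r) :
    ∫⁻ t : ℝ, ENNReal.ofReal (studentTDensity r t) = 1 := by
  have h1 : (0 : ℝ) < r := by exact_mod_cast hr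
  have h3 := Real.Gamma_pos_of_pos (show 0 < (r : ℝ) / 2 by positivity)
  have h5 : 0 < Real.sqrt ((r : ℝ) * π) := Real.sqrt_pos.2 (by positivity)
  have hC : 0 < Real.sqrt ((r : ℝ) * π) * Real.Gamma ((r : ℝ) / 2) := mul_pos h5 h3
  have e : ∀ t, ENNReal.ofReal (studentTDensity r t) =
      ENNReal.ofReal (Real.sqrt ((r : ℝ) * π) * Real.Gamma ((r : ℝ) / 2))⁻¹ *
      ENNReal.ofReal ((1 + t ^ 2 / (r : ℝ)) ^ (-(((r : ℝ) + 1) / 2)) *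
        Real.Gamma (((r : ℝ) + 1) / 2)) := by
    intro t
    rw [← ENNReal.ofReal_mul (by positivity)]
    congr 1
    unfold studentTDensity
    ring
  simp_rw [e]
  rw [lintegral_const_mul _ (by fun_prop), student_kernel_lintegral r hr,
    ← ENNReal.ofReal_mul (by positivity), inv_mul_cancel₀ hC.ne', ENNReal.ofReal_one]

lemma student_integrable (r : ℕ) (hr : 0 < r) : Integrable (studentTDensity r) := by
  refine ⟨(student_cont r).aestronglyMeasurable, ?_⟩
  rw [hasFiniteIntegral_iff_ofReal (Filter.Eventually.of_forall fun t => (student_pos r hr t).le),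
    student_lintegral r hr]
  exact ENNReal.one_lt_top

lemma student_integral (r : ℕ) (hr : 0 < r) : ∫ t, studentTDensity r t = 1 := by
  rw [integral_eq_lintegral_of_nonneg_ae
    (Filter.Eventually.of_forall fun t => (student_pos r hr t).le)
    (student_cont r).aestronglyMeasurable, student_lintegral r hr]
  simp

lemma student_sub (r : ℕ) (hr : 0 < r) (y z : ℝ) :
    ∫ u in y..z, studentTDensity r u = studentTCDF r z - studentTCDF r y :=
  (intervalIntegral.integral_Iic_sub_Iic (student_integrable r hr).integrableOn
    (student_integrable r hr).integrableOn).symm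

lemma student_strictMono (r : ℕ) (hr : 0 < r) : StrictMono (studentTCDF r) := by
  intro y z h
  have h1 := student_sub r hr y z
  have h2 : 0 < ∫ u in y..z, studentTDensity r u :=
    intervalIntegral.intervalIntegral_pos_of_pos
      ((student_cont r).intervalIntegrable _ _) (student_pos r hr) h
  linarith

lemma student_neg (r : ℕ) (hr : 0 < r) (y : ℝ) : studentTCDF r (-y) = 1 - studentTCDF r y := by
  have h1 : studentTCDF r (-y) = ∫ u in Set.Ioi y, studentTDensity r u := by
    unfold studentTCDF
    have := integral_comp_neg_Iic (-y) (studentTDensity r)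
    simpa [student_even] using this
  have h2 := intervalIntegral.integral_Iic_add_Ioi (b := y) (μ := volume)
    (student_integrable r hr).integrableOn (student_integrable r hr).integrableOn
  rw [student_integral r hr] at h2
  rw [h1]
  unfold studentTCDF
  linarith

lemma student_nonneg (r : ℕ) (hr : 0 < r) (y : ℝ) : 0 ≤ studentTCDF r y :=
  integral_nonneg fun u => (student_pos r hr u).le

lemma student_cdf_pos (r : ℕ) (hr : 0 < r) (y : ℝ) : 0 < studentTCDF r y :=
  (student_nonneg r hr (y - 1)).trans_lt (student_strictMono r hr (by linarith))

lemma student_cdf_lt_one (r : ℕ) (hr : 0 < r) (y : ℝ) : studentTCDF r y < 1 := by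
  have := student_cdf_pos r hr (-y)
  rw [student_neg r hr] at this
  linarith

/-- **The highest-posterior-density credible interval has posterior mass `1 − α`.**
Let `s = √(w/r)`, `t = x/s`, let `g(θ) = h_r((θ−x)/s)/(s H_r(t))` be the posterior
density of the constrained normal mean under the prior `1/σ`, and let `Hinv` be the
Student-t quantile function. With
`b = max{Hinv(1 − α H_r(t)), Hinv(1/2 + (1−α) H_r(t)/2)}`, `l = max{0, x − bs}` and
`u = x + bs`, one has `∫_l^u g(θ) dθ = 1 − α`. -/
theorem hpd_credible_interval_mass (r : ℕ) (hr : 0 < r)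
    (α : ℝ) (hα : α ∈ Set.Ioo (0 : ℝ) 1) (x w : ℝ) (hw : 0 < w)
    (Hinv : ℝ → ℝ)
    (hHinv : ∀ p ∈ Set.Ioo (0 : ℝ) 1, studentTCDF r (Hinv p) = p)
    (s t b l u : ℝ)
    (hs : s = Real.sqrt (w / r)) (ht : t = x / s)
    (hb : b = max (Hinv (1 - α * studentTCDF r t))
      (Hinv (1 / 2 + (1 - α) * studentTCDF r t / 2)))
    (hl : l = max 0 (x - b * s)) (hu : u = x + b * s) :
    ∫ θ in l..u, studentTDensity r ((θ - x) / s) / (s * studentTCDF r t) = 1 - α := by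
  have hrr : (0 : ℝ) < r := by exact_mod_cast hr
  have hs0 : 0 < s := hs ▸ Real.sqrt_pos.2 (by positivity)
  obtain ⟨hα0, hα1⟩ := hα
  have hH0 := student_cdf_pos r hr t
  have hH1 := student_cdf_lt_one r hr t
  have hmono := (student_strictMono r hr).monotone
  have hneg := student_neg r hr
  have hprod : 0 < α * studentTCDF r t := mul_pos hα0 hH0
  have hprod2 : α * studentTCDF r t < 1 := by nlinarith
  have hb1 := hHinv (1 - α * studentTCDF r t) ⟨by linarith, by linarith⟩
  have hb2 := hHinv (1 / 2 + (1 - α) * studentTCDF r t / 2) ⟨by nlinarith, by nlinarith⟩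
  have hHb : studentTCDF r b = max (1 - α * studentTCDF r t)
      (1 / 2 + (1 - α) * studentTCDF r t / 2) := by
    rw [hb, hmono.map_max, hb1, hb2]
  have hlow : (l - x) / s = max (-t) (-b) := by
    have hxt : x = t * s := by rw [ht]; field_simp
    rw [hl, hxt]
    rcases le_total (-t) (-b) with h | h
    · rw [max_eq_right h, max_eq_right (by nlinarith)]
      field_simp
      ring
    · rw [max_eq_left h, max_eq_left (by nlinarith)]
      field_simp
      ring
  have hupp : (u - x) / s = b := by
    rw [hu]
    field_simp
    ring
  have hint : ∫ θ in l..u, studentTDensity r ((θ - x) / s) / (s * studentTCDF r t)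
      = (∫ v in (l - x) / s..(u - x) / s, studentTDensity r v) / studentTCDF r t := by
    rw [intervalIntegral.integral_div,
      intervalIntegral.integral_comp_sub_right (fun z => studentTDensity r (z / s)) x,
      intervalIntegral.integral_comp_div (studentTDensity r) hs0.ne', smul_eq_mul]
    field_simp
  rw [hint, hlow, hupp, student_sub r hr, hmono.map_max, hneg, hneg, div_eq_iff hH0.ne']
  rcases le_total (1 - α * studentTCDF r t) (1 / 2 + (1 - α) * studentTCDF r t / 2) with h | h
  · rw [max_eq_right h] at hHb
    rw [hHb, max_eq_right (by linarith)]
    ring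
  · rw [max_eq_left h] at hHb
    rw [hHb, max_eq_left (by linarith)]
    ring
end

section
/- Let w and x be natural numbers and let m > 0, a > 0 and b ≥ 0 be reals. Define p(w, x | ε, λ) = ∑_{k=0}^{x} m^w ε^{w+k} λ^{x−k} e^{−λ − (m+1)ε} / ( w! · k! · (x−k)! ) for ε, λ ≥ 0. Then ∫_0^∞ ∫_0^∞ p(w, x | ε, λ) · ε^{a−1} e^{−bε} dε dλ = ∑_{k=0}^{x} Γ(a + w + k) / ( w! · k! ) · m^w / (b + m + 1)^{a+w+k}. -/
open MeasureTheory Real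

/-- The joint probability mass function of `(W, X)` in the constrained Poisson model:
`p(w,x|ε,λ) = ∑_{k=0}^{x} m^w ε^{w+k} λ^{x−k} e^{−λ−(m+1)ε} / (w! k! (x−k)!)`. -/
noncomputable def jointPMFPoisson (m : ℝ) (w x : ℕ) (ε l : ℝ) : ℝ :=
  ∑ k ∈ Finset.range (x + 1),
    m ^ w * ε ^ (w + k) * l ^ (x - k) * Real.exp (-l - (m + 1) * ε) /
      ((Nat.factorial w : ℝ) * (Nat.factorial k : ℝ) * (Nat.factorial (x - k) : ℝ))

lemma gamma_integrable_aux {s r : ℝ} (hs : 0 < s) (hr : 0 < r) :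
    IntegrableOn (fun t : ℝ => t ^ (s - 1) * Real.exp (-(r * t))) (Set.Ioi 0) := by
  have key := Real.integral_rpow_mul_exp_neg_mul_Ioi hs hr
  have hG := Real.Gamma_pos_of_pos hs
  exact .of_integral_ne_zero (by rw [key]; positivity)

/-- **Marginal probability mass of the data under the improper prior
`ε^{a−1} e^{−bε} dε dλ`.** For natural numbers `w, x` and reals `m > 0`, `a > 0`,
`b ≥ 0`,
`∫_0^∞ ∫_0^∞ p(w,x|ε,λ) ε^{a−1} e^{−bε} dε dλ
  = ∑_{k=0}^{x} Γ(a+w+k)/(w! k!) · m^w/(b+m+1)^{a+w+k}`. -/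
theorem poisson_marginal_improper_prior (w x : ℕ) (m a b : ℝ)
    (hm : 0 < m) (ha : 0 < a) (hb : 0 ≤ b) :
    ∫ l in Set.Ioi (0 : ℝ), ∫ ε in Set.Ioi (0 : ℝ),
        jointPMFPoisson m w x ε l * ε ^ (a - 1) * Real.exp (-b * ε) =
      ∑ k ∈ Finset.range (x + 1),
        Real.Gamma (a + w + k) / ((Nat.factorial w : ℝ) * (Nat.factorial k : ℝ)) *
          (m ^ w / (b + m + 1) ^ (a + (w : ℝ) + k)) := by
  have hr : 0 < b + m + 1 := by linarith
  have hs : ∀ k : ℕ, 0 < a + (w : ℝ) + k := fun k => by positivity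
  have hn : ∀ n : ℕ, (0 : ℝ) < (n : ℝ) + 1 := fun n => by positivity
  have inner : ∀ l : ℝ, ∫ ε in Set.Ioi (0 : ℝ),
        jointPMFPoisson m w x ε l * ε ^ (a - 1) * Real.exp (-b * ε) =
      ∑ k ∈ Finset.range (x + 1),
        (Real.Gamma (a + w + k) / ((Nat.factorial w : ℝ) * (Nat.factorial k : ℝ)) *
          (m ^ w / (b + m + 1) ^ (a + (w : ℝ) + k)) / (Nat.factorial (x - k) : ℝ)) *
          (l ^ ((((x - k : ℕ) : ℝ) + 1) - 1) * Real.exp (-(1 * l))) := by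
    intro l
    have h1 : ∫ ε in Set.Ioi (0 : ℝ),
        jointPMFPoisson m w x ε l * ε ^ (a - 1) * Real.exp (-b * ε) =
        ∫ ε in Set.Ioi (0 : ℝ), ∑ k ∈ Finset.range (x + 1),
          (m ^ w * l ^ (x - k) * Real.exp (-l) /
      ((Nat.factorial w : ℝ) * (Nat.factorial k : ℝ) * (Nat.factorial (x - k) : ℝ))) *
          (ε ^ ((a + (w : ℝ) + k) - 1) * Real.exp (-((b + m + 1) * ε))) := by
      refine setIntegral_congr_fun measurableSet_Ioi (fun ε hε => ?_)
      have hε' : (0 : ℝ) < ε := hε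
      simp only [jointPMFPoisson, Finset.sum_mul]
      refine Finset.sum_congr rfl (fun k _ => ?_)
      have e1 : ε ^ ((a + (w : ℝ) + k) - 1) = ε ^ (a - 1) * ε ^ (w + k) := by
        rw [← Real.rpow_natCast, ← Real.rpow_add hε']
        congr 1
        push_cast
        ring
      have e2 : Real.exp (-((b + m + 1) * ε)) =
          Real.exp (-((m + 1) * ε)) * Real.exp (-b * ε) := by
        rw [← Real.exp_add]
        congr 1
        ring
      rw [e1, e2, sub_eq_add_neg, Real.exp_add]
      ring
    rw [h1, integral_finsetSum _ (fun k _ => (gamma_integrable_aux (hs k) hr).const_mul _)]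
    refine Finset.sum_congr rfl (fun k _ => ?_)
    rw [integral_const_mul, Real.integral_rpow_mul_exp_neg_mul_Ioi (hs k) hr,
      add_sub_cancel_right, Real.rpow_natCast, one_mul, one_div, Real.inv_rpow hr.le]
    ring
  simp_rw [inner]
  rw [integral_finsetSum _
    (fun k _ => (gamma_integrable_aux (hn (x - k)) one_pos).const_mul _)]
  refine Finset.sum_congr rfl (fun k _ => ?_)
  rw [integral_const_mul, Real.integral_rpow_mul_exp_neg_mul_Ioi (hn (x - k)) one_pos,
    Real.Gamma_nat_eq_factorial, one_div, inv_one, Real.one_rpow, one_mul]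
  exact div_mul_cancel₀ _ (by positivity)
end

section
/- Let w and x be natural numbers and let m > 0, a > 0 and b ≥ 0 be reals. Define p(w, x | ε, λ) = ∑_{k=0}^{x} m^w ε^{w+k} λ^{x−k} e^{−λ − (m+1)ε} / ( w! · k! · (x−k)! ). Then for every λ ≥ 0, ∫_0^∞ p(w, x | ε, λ) · ε^{a−1} e^{−bε} dε = ∑_{k=0}^{x} Γ(a + w + k) / ( w! · k! · (x−k)! ) · m^w / (b + m + 1)^{a+w+k} · e^{−λ} λ^{x−k}. Consequently, integrating in λ over [0, Λ] gives ∫_0^Λ ∫_0^∞ p(w,x|ε,λ) ε^{a−1}e^{−bε} dε dλ = ∑_{k=0}^{x} Γ(a+w+k)/(w!·k!) · m^w (b+m+1)^{−(a+w+k)} · G_{x−k+1}(Λ), where G_j is the CDF of the Gamma distribution with shape j and rate 1. -/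
open MeasureTheory Real

/-- The CDF of the Gamma distribution with shape the positive integer `j` and rate `1`:
`G_j(Λ) = ∫_0^Λ t^{j−1} e^{−t}/(j−1)! dt`. -/
noncomputable def gammaCDFposNat (j : ℕ) (Λ : ℝ) : ℝ :=
  ∫ t in (0 : ℝ)..Λ, t ^ (j - 1) * Real.exp (-t) / (Nat.factorial (j - 1) : ℝ)

/-- **Posterior density and posterior distribution function of the signal rate.**
Integrating the joint pmf against the improper prior `ε^{a−1}e^{−bε}` in `ε` yields, for
every `λ ≥ 0`,
`∫_0^∞ p(w,x|ε,λ) ε^{a−1}e^{−bε} dε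
  = ∑_{k=0}^{x} Γ(a+w+k)/(w! k! (x−k)!) · m^w (b+m+1)^{−(a+w+k)} e^{−λ} λ^{x−k}`,
and integrating further in `λ` over `[0, Λ]` yields
`∑_{k=0}^{x} Γ(a+w+k)/(w! k!) · m^w (b+m+1)^{−(a+w+k)} G_{x−k+1}(Λ)`. -/
theorem poisson_posterior_improper_prior (w x : ℕ) (m a b : ℝ)
    (hm : 0 < m) (ha : 0 < a) (hb : 0 ≤ b) :
    (∀ l : ℝ, 0 ≤ l →
      ∫ ε in Set.Ioi (0 : ℝ),
          jointPMFPoisson m w x ε l * ε ^ (a - 1) * Real.exp (-b * ε) =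
        ∑ k ∈ Finset.range (x + 1),
          Real.Gamma (a + w + k) /
              ((Nat.factorial w : ℝ) * (Nat.factorial k : ℝ) * (Nat.factorial (x - k) : ℝ)) *
            (m ^ w * (b + m + 1) ^ (-(a + (w : ℝ) + k))) * (Real.exp (-l) * l ^ (x - k))) ∧
    (∀ Λ : ℝ, 0 ≤ Λ →
      ∫ l in (0 : ℝ)..Λ, ∫ ε in Set.Ioi (0 : ℝ),
          jointPMFPoisson m w x ε l * ε ^ (a - 1) * Real.exp (-b * ε) =
        ∑ k ∈ Finset.range (x + 1),
          Real.Gamma (a + w + k) / ((Nat.factorial w : ℝ) * (Nat.factorial k : ℝ)) *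
            (m ^ w * (b + m + 1) ^ (-(a + (w : ℝ) + k))) *
              gammaCDFposNat (x - k + 1) Λ) := by
  have hc : 0 < b + m + 1 := by linarith
  have key : ∀ l : ℝ,
      ∫ ε in Set.Ioi (0 : ℝ),
          jointPMFPoisson m w x ε l * ε ^ (a - 1) * Real.exp (-b * ε) =
        ∑ k ∈ Finset.range (x + 1),
          Real.Gamma (a + w + k) /
              ((Nat.factorial w : ℝ) * (Nat.factorial k : ℝ) * (Nat.factorial (x - k) : ℝ)) *
            (m ^ w * (b + m + 1) ^ (-(a + (w : ℝ) + k))) * (Real.exp (-l) * l ^ (x - k)) := by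
    intro l
    have h1 : ∀ ε ∈ Set.Ioi (0 : ℝ),
        jointPMFPoisson m w x ε l * ε ^ (a - 1) * Real.exp (-b * ε) =
        ∑ k ∈ Finset.range (x + 1),
          (m ^ w * (Real.exp (-l) * l ^ (x - k)) /
            ((Nat.factorial w : ℝ) * (Nat.factorial k : ℝ) * (Nat.factorial (x - k) : ℝ))) *
          (ε ^ (a + w + k - 1) * Real.exp (-((b + m + 1) * ε))) := by
      intro ε hε
      have hε' : 0 < ε := hε
      unfold jointPMFPoisson
      rw [Finset.sum_mul, Finset.sum_mul]
      refine Finset.sum_congr rfl fun k _ => ?_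
      have e1 : ε ^ (a + w + k - 1) = ε ^ (w + k) * ε ^ (a - 1) := by
        rw [← Real.rpow_natCast, ← Real.rpow_add hε']
        congr 1
        push_cast
        ring
      have e2 : Real.exp (-((b + m + 1) * ε)) * Real.exp (-l) =
          Real.exp (-l - (m + 1) * ε) * Real.exp (-b * ε) := by
        rw [← Real.exp_add, ← Real.exp_add]
        congr 1
        ring
      rw [e1]
      linear_combination (-(m ^ w * l ^ (x - k) * ε ^ (w + k) * ε ^ (a - 1) /
        ((Nat.factorial w : ℝ) * (Nat.factorial k : ℝ) * (Nat.factorial (x - k) : ℝ)))) * e2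
    rw [setIntegral_congr_fun measurableSet_Ioi h1, integral_finsetSum]
    · refine Finset.sum_congr rfl fun k _ => ?_
      have hs : 0 < a + w + k := by positivity
      rw [integral_const_mul, Real.integral_rpow_mul_exp_neg_mul_Ioi hs hc,
        Real.rpow_neg hc.le, one_div, Real.inv_rpow hc.le]
      ring
    · intro k _
      have hs : 0 < a + w + k := by positivity
      refine Integrable.const_mul ?_ _
      have := integrableOn_rpow_mul_exp_neg_mul_rpow (p := 1) (s := a + w + k - 1)
        (by linarith) one_pos hc
      simpa only [IntegrableOn, Real.rpow_one, neg_mul] using this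
  refine ⟨fun l _ => key l, fun Λ _ => ?_⟩
  simp_rw [key]
  rw [intervalIntegral.integral_finsetSum]
  · refine Finset.sum_congr rfl fun k _ => ?_
    unfold gammaCDFposNat
    rw [← intervalIntegral.integral_const_mul]
    refine intervalIntegral.integral_congr fun t _ => ?_
    simp only [Nat.add_sub_cancel]
    ring
  · intro k _
    apply Continuous.intervalIntegrable
    fun_prop
end
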